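/- Let A be the preprojective algebra of type 𝔸₃ over a field k. The module N = A ⊕ N₁ ⊕ N₂ ⊕ N₃, where N₁, N₂, N₃ are the indecomposable modules with radical filtrations [2;1], [2;3], [2;13] respectively, is a 2-cluster-tilting A-module and N has no simple direct summands; consequently Ext²_A(S, S') ≠ 0 for no pair of simple summands of N (the Ext²-quiver of add N is empty). -/

import Mathlib

noncomputable section

/-- Generators of the preprojective algebra of type `𝔸₃`: three vertex idempotents
`e₁, e₂, e₃` and four arrows `x₁ : 1 → 2`, `y₁ : 2 → 1`, `x₂ : 2 → 3`, `y₂ : 3 → 2`. -/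
inductive PreprojGen : Type
  | e1 | e2 | e3 | x1 | y1 | x2 | y2

open PreprojGen

variable (k : Type) [Field k]

/-- Shorthand for the generators inside the free algebra. -/
abbrev g (a : PreprojGen) : FreeAlgebra k PreprojGen := FreeAlgebra.ι k a

/-- The defining relations of the preprojective algebra of type `𝔸₃`: the `eᵢ` are
orthogonal idempotents summing to `1`, the arrows are compatible with the quiver structure
(`x₁ = e₂ x₁ e₁` etc.), and the preprojective relations `y₁x₁ = 0`, `x₂y₂ = 0`,
`x₁y₁ = y₂x₂` hold. -/
inductive PreprojRel : FreeAlgebra k PreprojGen → FreeAlgebra k PreprojGen → Prop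
  | idem1 : PreprojRel (g k e1 * g k e1) (g k e1)
  | idem2 : PreprojRel (g k e2 * g k e2) (g k e2)
  | idem3 : PreprojRel (g k e3 * g k e3) (g k e3)
  | orth12 : PreprojRel (g k e1 * g k e2) 0
  | orth13 : PreprojRel (g k e1 * g k e3) 0
  | orth21 : PreprojRel (g k e2 * g k e1) 0
  | orth23 : PreprojRel (g k e2 * g k e3) 0
  | orth31 : PreprojRel (g k e3 * g k e1) 0
  | orth32 : PreprojRel (g k e3 * g k e2) 0
  | sum : PreprojRel (g k e1 + g k e2 + g k e3) 1
  | x1l : PreprojRel (g k e2 * g k x1) (g k x1)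
  | x1r : PreprojRel (g k x1 * g k e1) (g k x1)
  | y1l : PreprojRel (g k e1 * g k y1) (g k y1)
  | y1r : PreprojRel (g k y1 * g k e2) (g k y1)
  | x2l : PreprojRel (g k e3 * g k x2) (g k x2)
  | x2r : PreprojRel (g k x2 * g k e2) (g k x2)
  | y2l : PreprojRel (g k e2 * g k y2) (g k y2)
  | y2r : PreprojRel (g k y2 * g k e3) (g k y2)
  | rel1 : PreprojRel (g k y1 * g k x1) 0
  | rel2 : PreprojRel (g k x2 * g k y2) 0
  | rel3 : PreprojRel (g k x1 * g k y1) (g k y2 * g k x2)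

/-- The preprojective algebra of type `𝔸₃` over `k`. -/
def PreprojA3 : Type := RingQuot (PreprojRel k)

instance : Ring (PreprojA3 k) := inferInstanceAs (Ring (RingQuot (PreprojRel k)))

instance : Algebra k (PreprojA3 k) := inferInstanceAs (Algebra k (RingQuot (PreprojRel k)))

open CategoryTheory CategoryTheory.Limits

/-- The image of a generator in the preprojective algebra. -/
noncomputable def gen (a : PreprojGen) : PreprojA3 k :=
  RingQuot.mkAlgHom k (PreprojRel k) (g k a)

/-- The indecomposable projective `P₂ = A e₂`. -/
noncomputable def P2 : Submodule (PreprojA3 k) (PreprojA3 k) :=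
  Submodule.span (PreprojA3 k) {gen k e2}

/-- The quotient of `P₂` by the submodule generated by `w ∈ A`. -/
noncomputable def P2Quot (w : PreprojA3 k) : Type :=
  ↥(P2 k) ⧸ (Submodule.span (PreprojA3 k) {w}).comap (P2 k).subtype

noncomputable instance (w : PreprojA3 k) : AddCommGroup (P2Quot k w) :=
  inferInstanceAs (AddCommGroup (↥(P2 k) ⧸ (Submodule.span (PreprojA3 k) {w}).comap (P2 k).subtype))

noncomputable instance (w : PreprojA3 k) : Module (PreprojA3 k) (P2Quot k w) :=
  inferInstanceAs (Module (PreprojA3 k) (↥(P2 k) ⧸ (Submodule.span (PreprojA3 k) {w}).comap (P2 k).subtype))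

/-- The uniserial module `[2;1]` with top `S₂` and socle `S₁`: the quotient of `P₂ = Ae₂`
by the submodule generated by `x₂`. -/
noncomputable def N1 : ModuleCat (PreprojA3 k) := ModuleCat.of _ (P2Quot k (gen k x2))

/-- The uniserial module `[2;3]` with top `S₂` and socle `S₃`: the quotient of `P₂ = Ae₂`
by the submodule generated by `y₁`. -/
noncomputable def N2 : ModuleCat (PreprojA3 k) := ModuleCat.of _ (P2Quot k (gen k y1))

/-- The module `[2;13]` with top `S₂` and socle `S₁ ⊕ S₃`: the quotient of `P₂ = Ae₂`
by the submodule generated by `x₁y₁`. -/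
noncomputable def N3 : ModuleCat (PreprojA3 k) :=
  ModuleCat.of _ (P2Quot k (gen k x1 * gen k y1))

/-- The module `N = A ⊕ [2;1] ⊕ [2;3] ⊕ [2;13]`. -/
noncomputable def NN : ModuleCat (PreprojA3 k) :=
  ModuleCat.of _ (PreprojA3 k × N1 k × N2 k × N3 k)

/-- `X` is a direct summand of `N`. -/
def IsSummand {L : Type*} [Ring L] (X N : ModuleCat L) : Prop :=
  ∃ (s : X ⟶ N) (r : N ⟶ X), s ≫ r = 𝟙 X

/-- `X` belongs to `add M`. -/
def MemAdd {L : Type*} [Ring L] (M X : ModuleCat L) : Prop :=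
  ∃ (n : ℕ) (s : X ⟶ ⨁ fun _ : Fin n => M) (r : (⨁ fun _ : Fin n => M) ⟶ X), s ≫ r = 𝟙 X

/-- Vanishing of `Ext^i(X, Y)`. -/
noncomputable def ExtVanish {L : Type*} [Ring L] (i : ℕ) (X Y : ModuleCat L) : Prop :=
  Subsingleton (((Ext ℤ (ModuleCat L) i).obj (Opposite.op X)).obj Y)

/-- `M` is a `d`-cluster-tilting module. -/
noncomputable def IsClusterTilting {L : Type*} [Ring L] (d : ℕ) (M : ModuleCat L) : Prop :=
  Module.Finite L M ∧
  (∀ X : ModuleCat L, Module.Finite L X →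
    (MemAdd M X ↔ ∀ i, 1 ≤ i → i ≤ d - 1 → ExtVanish i X M)) ∧
  (∀ Y : ModuleCat L, Module.Finite L Y →
    (MemAdd M Y ↔ ∀ i, 1 ≤ i → i ≤ d - 1 → ExtVanish i M Y))



section Homological

variable {L : Type} [Ring L]

/-- Extension form of the vanishing of `Ext¹(X, Y)`: for each surjection `π : E → X`, all maps
`ker π → Y` extend to `E`. -/
def ExtS (X Y : Type) [AddCommGroup X] [Module L X] [AddCommGroup Y] [Module L Y] : Prop :=
  ∀ (E : Type) [AddCommGroup E] [Module L E] (π : E →ₗ[L] X), Function.Surjective π →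
    ∀ f : LinearMap.ker π →ₗ[L] Y, ∃ h : E →ₗ[L] Y, ∀ z : LinearMap.ker π, h z = f z

lemma extS_of_proj {X Y : Type} [AddCommGroup X] [Module L X] [AddCommGroup Y] [Module L Y]
    {P : Type} [AddCommGroup P] [Module L P] [Module.Projective L P] (p : P →ₗ[L] X)
    (H : ∀ f : LinearMap.ker p →ₗ[L] Y, ∃ h : P →ₗ[L] Y, ∀ z : LinearMap.ker p, h z = f z) :
    Function.Surjective p → ExtS (L := L) X Y := by
  intro hp E _ _ π hπ f
  obtain ⟨φ, hφ⟩ := Module.projective_lifting_property π p hπ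
  have hφ' : ∀ q, π (φ q) = p q := fun q => by rw [← hφ]; rfl
  let φ' : LinearMap.ker p →ₗ[L] LinearMap.ker π :=
    (φ.comp (LinearMap.ker p).subtype).codRestrict (LinearMap.ker π) (by
      intro z; simp [hφ'])
  obtain ⟨g, hg⟩ := H (f.comp φ')
  -- the surjection P × ker π → E
  let q : P × LinearMap.ker π →ₗ[L] E := φ.coprod (LinearMap.ker π).subtype
  have hq : Function.Surjective q := by
    intro e
    obtain ⟨a, ha⟩ := hp (π e)
    refine ⟨(a, ⟨e - φ a, by simp [hφ', ha]⟩), by simp [q]⟩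
  let t : P × LinearMap.ker π →ₗ[L] Y := g.coprod f
  have hker : LinearMap.ker q ≤ LinearMap.ker t := by
    rintro ⟨a, z⟩ haz
    have h1 : φ a + (z : E) = 0 := by simpa [q] using haz
    have h2 : p a = 0 := by
      have := congrArg π h1
      simpa [hφ'] using this
    have h3 := hg ⟨a, h2⟩
    have h4 : φ' ⟨a, h2⟩ = -z := by
      ext
      exact eq_neg_of_add_eq_zero_left h1
    simp only [LinearMap.comp_apply, h4, map_neg] at h3
    simp [t, h3]
  refine ⟨((LinearMap.ker q).liftQ t hker).comp
    (LinearMap.quotKerEquivOfSurjective q hq).symm.toLinearMap, fun z => ?_⟩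
  have : (LinearMap.quotKerEquivOfSurjective q hq).symm (z : E)
      = (LinearMap.ker q).mkQ (0, z) := by
    rw [LinearEquiv.symm_apply_eq]
    simp [q]
  simp only [LinearMap.comp_apply, LinearEquiv.coe_coe, this]
  simp [t]

/-- Functorial closure of `ExtS` in the first variable. -/
lemma ExtS.sum_left {M X Y : Type} [AddCommGroup X] [Module L X] [AddCommGroup Y] [Module L Y]
    [AddCommGroup M] [Module L M] (n : ℕ) (s : Fin n → (X →ₗ[L] M)) (r : Fin n → (M →ₗ[L] X))
    (hsr : ∀ x, ∑ i, r i (s i x) = x) (H : ExtS (L := L) M Y) : ExtS (L := L) X Y := by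
  let p : (X →₀ L) →ₗ[L] X := Finsupp.linearCombination L id
  have hp : Function.Surjective p := fun x => ⟨Finsupp.single x 1, by simp [p]⟩
  let pM : (M →₀ L) →ₗ[L] M := Finsupp.linearCombination L id
  have hpM : Function.Surjective pM := fun x => ⟨Finsupp.single x 1, by simp [pM]⟩
  refine extS_of_proj p ?_ hp
  intro f
  have h1 : ∀ i, ∃ σ : (X →₀ L) →ₗ[L] (M →₀ L), pM.comp σ = (s i).comp p := fun i =>
    Module.projective_lifting_property pM _ hpM
  have h2 : ∀ i, ∃ ρ : (M →₀ L) →ₗ[L] (X →₀ L), p.comp ρ = (r i).comp pM := fun i =>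
    Module.projective_lifting_property p _ hp
  choose σ hσ using h1
  choose ρ hρ using h2
  have hσ' : ∀ i q, pM (σ i q) = s i (p q) := fun i q => LinearMap.congr_fun (hσ i) q
  have hρ' : ∀ i q, p (ρ i q) = r i (pM q) := fun i q => LinearMap.congr_fun (hρ i) q
  have h3 : ∀ i, ∃ h : (M →₀ L) →ₗ[L] Y, ∀ z : LinearMap.ker pM,
      h z = f ⟨ρ i z, by have := z.2; rw [LinearMap.mem_ker] at this ⊢; simp [hρ', this]⟩ := by
    intro i
    exact H _ pM hpM (f.comp (((ρ i).comp (LinearMap.ker pM).subtype).codRestrict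
      (LinearMap.ker p) (fun z => by
        have := z.2; rw [LinearMap.mem_ker] at this ⊢; simp [hρ', this])))
  choose h hh using h3
  let δ : (X →₀ L) →ₗ[L] LinearMap.ker p :=
    (LinearMap.id - ∑ i, (ρ i).comp (σ i)).codRestrict (LinearMap.ker p) (by
      intro q
      rw [LinearMap.mem_ker]
      simp [LinearMap.sum_apply, hρ', hσ', hsr])
  refine ⟨∑ i, (h i).comp (σ i) + f.comp δ, fun z => ?_⟩
  have hz : p z = 0 := z.2
  have h5 : ∀ i, σ i z ∈ LinearMap.ker pM := fun i => by
    rw [LinearMap.mem_ker, hσ', hz, map_zero]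
  have h6 : ∀ i, ρ i (σ i z) ∈ LinearMap.ker p := fun i => by
    rw [LinearMap.mem_ker, hρ', hσ', hz, map_zero, map_zero]
  have h7 : ∀ i, h i (σ i z) = f ⟨ρ i (σ i z), h6 i⟩ := fun i => hh i ⟨σ i z, h5 i⟩
  simp only [LinearMap.add_apply, LinearMap.sum_apply, LinearMap.comp_apply, h7]
  rw [← map_sum, ← map_add]
  congr 1
  ext1
  simp [δ, LinearMap.sum_apply]

lemma ExtS.sum_right {M X Y : Type} [AddCommGroup X] [Module L X] [AddCommGroup Y] [Module L Y]
    [AddCommGroup M] [Module L M] (n : ℕ) (s : Fin n → (Y →ₗ[L] M)) (r : Fin n → (M →ₗ[L] Y))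
    (hsr : ∀ x, ∑ i, r i (s i x) = x) (H : ExtS (L := L) X M) : ExtS (L := L) X Y := by
  intro E _ _ π hπ f
  have := fun i => H E π hπ ((s i).comp f)
  choose h hh using this
  refine ⟨∑ i, (r i).comp (h i), fun z => ?_⟩
  simp [LinearMap.sum_apply, hh, hsr]

lemma ExtS.retract_left {M X Y : Type} [AddCommGroup X] [Module L X] [AddCommGroup Y]
    [Module L Y] [AddCommGroup M] [Module L M] (s : X →ₗ[L] M) (r : M →ₗ[L] X)
    (hsr : ∀ x, r (s x) = x) (H : ExtS (L := L) M Y) : ExtS (L := L) X Y :=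
  ExtS.sum_left 1 (fun _ => s) (fun _ => r) (by simpa using hsr) H

lemma ExtS.retract_right {M X Y : Type} [AddCommGroup X] [Module L X] [AddCommGroup Y]
    [Module L Y] [AddCommGroup M] [Module L M] (s : Y →ₗ[L] M) (r : M →ₗ[L] Y)
    (hsr : ∀ x, r (s x) = x) (H : ExtS (L := L) X M) : ExtS (L := L) X Y :=
  ExtS.sum_right 1 (fun _ => s) (fun _ => r) (by simpa using hsr) H

lemma ExtS.prod {X X' Y : Type} [AddCommGroup X] [Module L X] [AddCommGroup Y]
    [Module L Y] [AddCommGroup X'] [Module L X']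
    (H : ExtS (L := L) X Y) (H' : ExtS (L := L) X' Y) : ExtS (L := L) (X × X') Y := by
  intro E _ _ π hπ f
  let π' : E →ₗ[L] X' := (LinearMap.snd L X X').comp π
  have hπ' : Function.Surjective π' := Prod.snd_surjective.comp hπ
  let π₁ : LinearMap.ker π' →ₗ[L] X :=
    ((LinearMap.fst L X X').comp π).comp (LinearMap.ker π').subtype
  have hπ₁ : Function.Surjective π₁ := by
    intro x
    obtain ⟨e, he⟩ := hπ (x, 0)
    exact ⟨⟨e, by simp [π', he]⟩, by simp [π₁, he]⟩
  have key : ∀ z : LinearMap.ker π₁, ((z : LinearMap.ker π') : E) ∈ LinearMap.ker π := by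
    rintro ⟨⟨e, h1⟩, h2⟩
    rw [LinearMap.mem_ker] at h1 h2 ⊢
    exact Prod.ext h2 h1
  obtain ⟨h, hh⟩ := H _ π₁ hπ₁ (f.comp
    (((LinearMap.ker π').subtype.comp (LinearMap.ker π₁).subtype).codRestrict _ key))
  obtain ⟨h', hh'⟩ := H' _ π' hπ' h
  refine ⟨h', fun z => ?_⟩
  have hz : π z = 0 := z.2
  have hz1 : (z : E) ∈ LinearMap.ker π' := by rw [LinearMap.mem_ker]; simp [π', hz]
  have hz2 : (⟨z, hz1⟩ : LinearMap.ker π') ∈ LinearMap.ker π₁ := by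
    rw [LinearMap.mem_ker]; simp [π₁, hz]
  exact (hh' ⟨z, hz1⟩).trans (hh ⟨⟨z, hz1⟩, hz2⟩)

lemma extS_of_projective {X Y : Type} [AddCommGroup X] [Module L X] [AddCommGroup Y]
    [Module L Y] [Module.Projective L X] : ExtS (L := L) X Y := by
  refine extS_of_proj (LinearMap.id : X →ₗ[L] X) (fun f => ⟨0, fun z => ?_⟩)
    Function.surjective_id
  have : z = 0 := Subtype.ext z.2
  rw [this]; exact (map_zero f).symm

lemma extVanish_iff (X Y : ModuleCat.{0} L) : ExtVanish 1 X Y ↔ ExtS (L := L) X Y := by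
  let P := ProjectiveResolution.of X
  have e := P.isoExt (R := ℤ) 1 Y
  have h1 : ExtVanish 1 X Y ↔
      ∀ f : P.complex.X 1 ⟶ Y, P.complex.d 2 1 ≫ f = 0 →
        ∃ g : P.complex.X 0 ⟶ Y, P.complex.d 1 0 ≫ g = f := by
    unfold ExtVanish
    rw [← ModuleCat.isZero_iff_subsingleton, e.isZero_iff,
      ← HomologicalComplex.exactAt_iff_isZero_homology,
      HomologicalComplex.exactAt_iff' _ 0 1 2 (by simp) (by simp),
      ShortComplex.moduleCat_exact_iff]
    rfl
  rw [h1]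
  have hex : ∀ x : P.complex.X 1, (P.complex.d 1 0).hom x = 0 →
      ∃ y : P.complex.X 2, (P.complex.d 2 1).hom y = x := by
    have := P.exact_succ 0
    rw [ShortComplex.moduleCat_exact_iff] at this
    exact this
  have hex0 : ∀ x : P.complex.X 0, (P.π.f 0).hom x = 0 →
      ∃ y : P.complex.X 1, (P.complex.d 1 0).hom y = x := by
    have := P.exact₀
    rw [ShortComplex.moduleCat_exact_iff] at this
    exact this
  have hpr : Module.Projective L (P.complex.X 0) :=
    (IsProjective.iff_projective _).mpr (P.projective 0)
  let p : P.complex.X 0 →ₗ[L] X := (P.π.f 0).hom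
  have hp : Function.Surjective p := (ModuleCat.epi_iff_surjective (P.π.f 0)).mp inferInstance
  have hdp : ∀ y, p ((P.complex.d 1 0).hom y) = 0 := by
    intro y
    have := P.complex_d_comp_π_f_zero
    exact LinearMap.congr_fun (congrArg ModuleCat.Hom.hom this) y
  let d : P.complex.X 1 →ₗ[L] LinearMap.ker p := (P.complex.d 1 0).hom.codRestrict _ hdp
  have hd : Function.Surjective d := by
    rintro ⟨z, hz⟩
    obtain ⟨y, hy⟩ := hex0 z hz
    exact ⟨y, Subtype.ext hy⟩
  constructor
  · intro H
    refine extS_of_proj p ?_ hp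
    intro f
    obtain ⟨g, hg⟩ := H (ModuleCat.ofHom (f.comp d)) (by
      ext y
      have h0 : d ((P.complex.d 2 1).hom y) = 0 := by
        ext
        exact LinearMap.congr_fun (congrArg ModuleCat.Hom.hom (P.complex.d_comp_d 2 1 0)) y
      change f (d ((P.complex.d 2 1).hom y)) = 0
      rw [h0, map_zero])
    refine ⟨g.hom, fun z => ?_⟩
    obtain ⟨y, rfl⟩ := hd z
    exact LinearMap.congr_fun (congrArg ModuleCat.Hom.hom hg) y
  · intro H f hf
    have hk : LinearMap.ker d ≤ LinearMap.ker f.hom := by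
      intro y hy
      have hy' : (P.complex.d 1 0).hom y = 0 := congrArg Subtype.val hy
      obtain ⟨w, rfl⟩ := hex y hy'
      exact LinearMap.congr_fun (congrArg ModuleCat.Hom.hom hf) w
    obtain ⟨h, hh⟩ := H _ p hp (((LinearMap.ker d).liftQ f.hom hk).comp
      (LinearMap.quotKerEquivOfSurjective d hd).symm.toLinearMap)
    refine ⟨ModuleCat.ofHom h, ?_⟩
    ext y
    have h1 := hh (d y)
    have h2 : (LinearMap.quotKerEquivOfSurjective d hd).symm (d y)
        = (LinearMap.ker d).mkQ y := by
      rw [LinearEquiv.symm_apply_eq]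
      rfl
    simp only [LinearMap.comp_apply, LinearEquiv.coe_coe, h2] at h1
    exact h1

end Homological


section AddCat

/-- Explicit form of membership in `add M`. -/
def InAdd {L : Type} [Ring L] (M X : Type) [AddCommGroup M] [Module L M] [AddCommGroup X]
    [Module L X] : Prop :=
  ∃ (n : ℕ) (s : Fin n → (X →ₗ[L] M)) (r : Fin n → (M →ₗ[L] X)), ∀ x, ∑ i, r i (s i x) = x

lemma memAdd_iff {L : Type} [Ring L] (M X : ModuleCat.{0} L) :
    MemAdd M X ↔ InAdd (L := L) M X := by
  constructor
  · rintro ⟨n, s, r, h⟩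
    refine ⟨n, fun i => (s ≫ biproduct.π (fun _ : Fin n => M) i).hom,
      fun i => (biproduct.ι (fun _ : Fin n => M) i ≫ r).hom, fun x => ?_⟩
    have h2 : ∑ i, (s ≫ biproduct.π (fun _ : Fin n => M) i) ≫
        (biproduct.ι (fun _ : Fin n => M) i ≫ r) = 𝟙 X := by
      have h3 : ∀ i, (s ≫ biproduct.π (fun _ : Fin n => M) i) ≫
        (biproduct.ι (fun _ : Fin n => M) i ≫ r) =
          s ≫ (biproduct.π (fun _ : Fin n => M) i ≫ biproduct.ι (fun _ : Fin n => M) i) ≫ r := by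
        intro i; simp only [Category.assoc]
      simp only [h3]
      rw [← Preadditive.comp_sum, ← Preadditive.sum_comp, biproduct.total, Category.id_comp, h]
    have h4 := LinearMap.congr_fun (congrArg ModuleCat.Hom.hom h2) x
    rw [ModuleCat.hom_sum, LinearMap.sum_apply] at h4
    exact h4
  · rintro ⟨n, s, r, h⟩
    refine ⟨n, biproduct.lift fun i => ModuleCat.ofHom (s i),
      biproduct.desc fun i => ModuleCat.ofHom (r i), ?_⟩
    rw [biproduct.lift_desc]
    ext x
    rw [ModuleCat.hom_sum, LinearMap.sum_apply]
    exact h x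

variable {L : Type} [Ring L] {M X X' : Type} [AddCommGroup M] [Module L M] [AddCommGroup X]
    [Module L X] [AddCommGroup X'] [Module L X']

lemma InAdd.self : InAdd (L := L) M M :=
  ⟨1, fun _ => LinearMap.id, fun _ => LinearMap.id, by simp⟩

lemma InAdd.of_retract (s : X →ₗ[L] X') (r : X' →ₗ[L] X) (h : ∀ x, r (s x) = x)
    (H : InAdd (L := L) M X') : InAdd (L := L) M X := by
  obtain ⟨n, s', r', h'⟩ := H
  refine ⟨n, fun i => (s' i).comp s, fun i => r.comp (r' i), fun x => ?_⟩
  simp only [LinearMap.comp_apply, ← map_sum, h', h]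

/-- If the identity of `X` is the sum of a map factoring through `M` and one through `X'`. -/
lemma InAdd.of_sum {M' : Type} [AddCommGroup M'] [Module L M']
    (s : X →ₗ[L] M') (r : M' →ₗ[L] X) (s' : X →ₗ[L] X') (r' : X' →ₗ[L] X)
    (h : ∀ x, r (s x) + r' (s' x) = x) (H' : InAdd (L := L) M M')
    (H : InAdd (L := L) M X') : InAdd (L := L) M X := by
  obtain ⟨n, t, u, h1⟩ := H
  obtain ⟨m, t', u', h1'⟩ := H'
  refine ⟨m + n, Fin.addCases (fun i => (t' i).comp s) (fun i => (t i).comp s'),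
    Fin.addCases (fun i => r.comp (u' i)) (fun i => r'.comp (u i)), fun x => ?_⟩
  rw [Fin.sum_univ_add]
  simp [← map_sum, h1, h1', h]

end AddCat

section Algebra

/-- source vertex -/
def srcV : PreprojGen → Fin 3
  | e1 => 0 | e2 => 1 | e3 => 2 | x1 => 0 | y1 => 1 | x2 => 1 | y2 => 2

/-- target vertex -/
def tgtV : PreprojGen → Fin 3
  | e1 => 0 | e2 => 1 | e3 => 2 | x1 => 1 | y1 => 0 | x2 => 2 | y2 => 1

/-- idempotent at a vertex -/
def idemV : Fin 3 → PreprojGen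
  | 0 => e1 | 1 => e2 | 2 => e3

lemma gen_rel {a b : FreeAlgebra k PreprojGen} (h : PreprojRel k a b) :
    RingQuot.mkAlgHom k (PreprojRel k) a = RingQuot.mkAlgHom k (PreprojRel k) b :=
  RingQuot.mkAlgHom_rel k h

lemma gen_tgt (a : PreprojGen) : gen k (idemV (tgtV a)) * gen k a = gen k a := by
  cases a
  · exact (map_mul (RingQuot.mkAlgHom k (PreprojRel k)) _ _).symm.trans (gen_rel k .idem1)
  · exact (map_mul (RingQuot.mkAlgHom k (PreprojRel k)) _ _).symm.trans (gen_rel k .idem2)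
  · exact (map_mul (RingQuot.mkAlgHom k (PreprojRel k)) _ _).symm.trans (gen_rel k .idem3)
  · exact (map_mul (RingQuot.mkAlgHom k (PreprojRel k)) _ _).symm.trans (gen_rel k .x1l)
  · exact (map_mul (RingQuot.mkAlgHom k (PreprojRel k)) _ _).symm.trans (gen_rel k .y1l)
  · exact (map_mul (RingQuot.mkAlgHom k (PreprojRel k)) _ _).symm.trans (gen_rel k .x2l)
  · exact (map_mul (RingQuot.mkAlgHom k (PreprojRel k)) _ _).symm.trans (gen_rel k .y2l)

lemma gen_src (a : PreprojGen) : gen k a * gen k (idemV (srcV a)) = gen k a := by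
  cases a
  · exact (map_mul (RingQuot.mkAlgHom k (PreprojRel k)) _ _).symm.trans (gen_rel k .idem1)
  · exact (map_mul (RingQuot.mkAlgHom k (PreprojRel k)) _ _).symm.trans (gen_rel k .idem2)
  · exact (map_mul (RingQuot.mkAlgHom k (PreprojRel k)) _ _).symm.trans (gen_rel k .idem3)
  · exact (map_mul (RingQuot.mkAlgHom k (PreprojRel k)) _ _).symm.trans (gen_rel k .x1r)
  · exact (map_mul (RingQuot.mkAlgHom k (PreprojRel k)) _ _).symm.trans (gen_rel k .y1r)
  · exact (map_mul (RingQuot.mkAlgHom k (PreprojRel k)) _ _).symm.trans (gen_rel k .x2r)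
  · exact (map_mul (RingQuot.mkAlgHom k (PreprojRel k)) _ _).symm.trans (gen_rel k .y2r)

lemma gen_orth {i j : Fin 3} (h : i ≠ j) : gen k (idemV i) * gen k (idemV j) = 0 := by
  have key : ∀ {a b : PreprojGen}, PreprojRel k (g k a * g k b) 0 → gen k a * gen k b = 0 :=
    fun {a b} hr => ((map_mul (RingQuot.mkAlgHom k (PreprojRel k)) _ _).symm.trans
      (gen_rel k hr)).trans (map_zero _)
  fin_cases i <;> fin_cases j <;> first
    | exact absurd rfl h
    | exact key .orth12
    | exact key .orth13
    | exact key .orth21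
    | exact key .orth23
    | exact key .orth31
    | exact key .orth32

lemma gen_mul_zero {a b : PreprojGen} (h : srcV a ≠ tgtV b) : gen k a * gen k b = 0 := by
  rw [← gen_src k a, ← gen_tgt k b, mul_assoc, ← mul_assoc (gen k (idemV (srcV a))),
    gen_orth k h, zero_mul, mul_zero]

lemma gen_sum : gen k e1 + gen k e2 + gen k e3 = 1 := by
  have := gen_rel k .sum
  rw [map_add, map_add, map_one] at this
  exact this

lemma gen_rel1 : gen k y1 * gen k x1 = 0 :=
  ((map_mul (RingQuot.mkAlgHom k (PreprojRel k)) _ _).symm.trans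
      (gen_rel k .rel1)).trans (map_zero _)

lemma gen_rel2 : gen k x2 * gen k y2 = 0 :=
  ((map_mul (RingQuot.mkAlgHom k (PreprojRel k)) _ _).symm.trans
      (gen_rel k .rel2)).trans (map_zero _)

lemma gen_rel3 : gen k y2 * gen k x2 = gen k x1 * gen k y1 :=
  ((map_mul (RingQuot.mkAlgHom k (PreprojRel k)) _ _).symm.trans
      (gen_rel k .rel3).symm).trans (map_mul _ _ _)

variable {k}

lemma gen_induction {p : PreprojA3 k → Prop} (hc : ∀ c : k, p (algebraMap k _ c))
    (hg : ∀ a, p (gen k a)) (hm : ∀ a b, p a → p b → p (a * b))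
    (ha : ∀ a b, p a → p b → p (a + b)) (a : PreprojA3 k) : p a := by
  obtain ⟨b, rfl⟩ := RingQuot.mkAlgHom_surjective k (PreprojRel k) a
  induction b using FreeAlgebra.induction with
  | grade0 c =>
    rw [AlgHom.commutes]
    exact hc c
  | grade1 x => exact hg x
  | mul a b h1 h2 => rw [map_mul]; exact hm _ _ h1 h2
  | add a b h1 h2 => rw [map_add]; exact ha _ _ h1 h2

section act

variable {X : Type} [AddCommGroup X] [Module (PreprojA3 k) X] (v : X)

lemma act_zero {a b : PreprojGen} (h : srcV a ≠ tgtV b) :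
    gen k a • gen k b • v = 0 := by rw [← mul_smul, gen_mul_zero k h, zero_smul]

lemma act_tgt (a : PreprojGen) : gen k (idemV (tgtV a)) • gen k a • v = gen k a • v := by
  rw [← mul_smul, gen_tgt]

lemma act_src (a : PreprojGen) : gen k a • gen k (idemV (srcV a)) • v = gen k a • v := by
  rw [← mul_smul, gen_src]

@[simp] lemma act_e1e2 : gen k e1 • gen k e2 • v = 0 := act_zero v (by decide)
@[simp] lemma act_e1e3 : gen k e1 • gen k e3 • v = 0 := act_zero v (by decide)
@[simp] lemma act_e1x1 : gen k e1 • gen k x1 • v = 0 := act_zero v (by decide)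
@[simp] lemma act_e1x2 : gen k e1 • gen k x2 • v = 0 := act_zero v (by decide)
@[simp] lemma act_e1y2 : gen k e1 • gen k y2 • v = 0 := act_zero v (by decide)
@[simp] lemma act_e2e1 : gen k e2 • gen k e1 • v = 0 := act_zero v (by decide)
@[simp] lemma act_e2e3 : gen k e2 • gen k e3 • v = 0 := act_zero v (by decide)
@[simp] lemma act_e2y1 : gen k e2 • gen k y1 • v = 0 := act_zero v (by decide)
@[simp] lemma act_e2x2 : gen k e2 • gen k x2 • v = 0 := act_zero v (by decide)
@[simp] lemma act_e3e1 : gen k e3 • gen k e1 • v = 0 := act_zero v (by decide)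
@[simp] lemma act_e3e2 : gen k e3 • gen k e2 • v = 0 := act_zero v (by decide)
@[simp] lemma act_e3x1 : gen k e3 • gen k x1 • v = 0 := act_zero v (by decide)
@[simp] lemma act_e3y1 : gen k e3 • gen k y1 • v = 0 := act_zero v (by decide)
@[simp] lemma act_e3y2 : gen k e3 • gen k y2 • v = 0 := act_zero v (by decide)
@[simp] lemma act_x1e2 : gen k x1 • gen k e2 • v = 0 := act_zero v (by decide)
@[simp] lemma act_x1e3 : gen k x1 • gen k e3 • v = 0 := act_zero v (by decide)
@[simp] lemma act_x1x1 : gen k x1 • gen k x1 • v = 0 := act_zero v (by decide)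
@[simp] lemma act_x1x2 : gen k x1 • gen k x2 • v = 0 := act_zero v (by decide)
@[simp] lemma act_x1y2 : gen k x1 • gen k y2 • v = 0 := act_zero v (by decide)
@[simp] lemma act_y1e1 : gen k y1 • gen k e1 • v = 0 := act_zero v (by decide)
@[simp] lemma act_y1e3 : gen k y1 • gen k e3 • v = 0 := act_zero v (by decide)
@[simp] lemma act_y1y1 : gen k y1 • gen k y1 • v = 0 := act_zero v (by decide)
@[simp] lemma act_y1x2 : gen k y1 • gen k x2 • v = 0 := act_zero v (by decide)
@[simp] lemma act_x2e1 : gen k x2 • gen k e1 • v = 0 := act_zero v (by decide)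
@[simp] lemma act_x2e3 : gen k x2 • gen k e3 • v = 0 := act_zero v (by decide)
@[simp] lemma act_x2y1 : gen k x2 • gen k y1 • v = 0 := act_zero v (by decide)
@[simp] lemma act_x2x2 : gen k x2 • gen k x2 • v = 0 := act_zero v (by decide)
@[simp] lemma act_y2e1 : gen k y2 • gen k e1 • v = 0 := act_zero v (by decide)
@[simp] lemma act_y2e2 : gen k y2 • gen k e2 • v = 0 := act_zero v (by decide)
@[simp] lemma act_y2x1 : gen k y2 • gen k x1 • v = 0 := act_zero v (by decide)
@[simp] lemma act_y2y1 : gen k y2 • gen k y1 • v = 0 := act_zero v (by decide)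
@[simp] lemma act_y2y2 : gen k y2 • gen k y2 • v = 0 := act_zero v (by decide)
@[simp] lemma act_e1e1 : gen k e1 • gen k e1 • v = gen k e1 • v := act_tgt v e1
@[simp] lemma act_e2e2 : gen k e2 • gen k e2 • v = gen k e2 • v := act_tgt v e2
@[simp] lemma act_e3e3 : gen k e3 • gen k e3 • v = gen k e3 • v := act_tgt v e3
@[simp] lemma act_e2x1 : gen k e2 • gen k x1 • v = gen k x1 • v := act_tgt v x1
@[simp] lemma act_e1y1 : gen k e1 • gen k y1 • v = gen k y1 • v := act_tgt v y1
@[simp] lemma act_e3x2 : gen k e3 • gen k x2 • v = gen k x2 • v := act_tgt v x2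
@[simp] lemma act_e2y2 : gen k e2 • gen k y2 • v = gen k y2 • v := act_tgt v y2
@[simp] lemma act_x1e1 : gen k x1 • gen k e1 • v = gen k x1 • v := act_src v x1
@[simp] lemma act_y1e2 : gen k y1 • gen k e2 • v = gen k y1 • v := act_src v y1
@[simp] lemma act_x2e2 : gen k x2 • gen k e2 • v = gen k x2 • v := act_src v x2
@[simp] lemma act_y2e3 : gen k y2 • gen k e3 • v = gen k y2 • v := act_src v y2
@[simp] lemma act_y1x1 : gen k y1 • gen k x1 • v = 0 := by
  rw [← mul_smul, gen_rel1, zero_smul]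
@[simp] lemma act_x2y2 : gen k x2 • gen k y2 • v = 0 := by
  rw [← mul_smul, gen_rel2, zero_smul]
@[simp] lemma act_y2x2 : gen k y2 • gen k x2 • v = gen k x1 • gen k y1 • v := by
  rw [← mul_smul, gen_rel3, mul_smul]
@[simp] lemma act_x2x1y1 : gen k x2 • gen k x1 • gen k y1 • v = 0 := by
  rw [← act_y2x2, act_x2y2]
@[simp] lemma act_x1y1y2 : gen k x1 • gen k y1 • gen k y2 • v = 0 := by
  rw [← act_y2x2, act_x2y2, smul_zero]

lemma act_sum : gen k e1 • v + gen k e2 • v + gen k e3 • v = v := by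
  rw [← add_smul, ← add_smul, gen_sum, one_smul]

end act

/-- A `k`-linear map commuting with the generators is linear. -/
def mkLin {X Y : Type} [AddCommGroup X] [Module (PreprojA3 k) X] [AddCommGroup Y]
    [Module (PreprojA3 k) Y] [Module k X] [Module k Y] [IsScalarTower k (PreprojA3 k) X]
    [IsScalarTower k (PreprojA3 k) Y] (f : X →ₗ[k] Y)
    (h : ∀ (a : PreprojGen) (x : X), f (gen k a • x) = gen k a • f x) :
    X →ₗ[PreprojA3 k] Y where
  toFun := f
  map_add' := f.map_add
  map_smul' := by
    intro a
    induction a using gen_induction with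
    | hc c => intro x; simp
    | hg a => exact h a
    | hm a b h1 h2 =>
      intro x
      simp only [RingHom.id_apply] at h1 h2 ⊢
      rw [mul_smul, h1, h2, mul_smul]
    | ha a b h1 h2 =>
      intro x
      simp only [RingHom.id_apply] at h1 h2 ⊢
      rw [add_smul, map_add, h1, h2, add_smul]

@[simp] lemma mkLin_apply {X Y : Type} [AddCommGroup X] [Module (PreprojA3 k) X] [AddCommGroup Y]
    [Module (PreprojA3 k) Y] [Module k X] [Module k Y] [IsScalarTower k (PreprojA3 k) X]
    [IsScalarTower k (PreprojA3 k) Y] (f : X →ₗ[k] Y)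
    (h : ∀ (a : PreprojGen) (x : X), f (gen k a • x) = gen k a • f x) (x : X) :
    mkLin f h x = f x := rfl

/-- A module given by the action of the generators. -/
def RepMod {V : Type} [AddCommGroup V] [Module k V] (T : PreprojGen → Module.End k V)
    (_ : ∀ a b, PreprojRel k a b → FreeAlgebra.lift k T a = FreeAlgebra.lift k T b) : Type := V

section RepMod

variable {V : Type} [AddCommGroup V] [Module k V] (T : PreprojGen → Module.End k V)
    (h : ∀ a b, PreprojRel k a b → FreeAlgebra.lift k T a = FreeAlgebra.lift k T b)

instance : AddCommGroup (RepMod T h) := inferInstanceAs (AddCommGroup V)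
instance instRepModk : Module k (RepMod T h) := inferInstanceAs (Module k V)

/-- The structure map of a representation. -/
def repHom : PreprojA3 k →ₐ[k] Module.End k V :=
  RingQuot.liftAlgHom k ⟨FreeAlgebra.lift k T, fun {a b} => h a b⟩

instance : Module (PreprojA3 k) (RepMod T h) :=
  Module.compHom V (repHom T h).toRingHom

lemma repMod_smul (a : PreprojA3 k) (v : RepMod T h) : a • v = (repHom T h a : V → V) v := rfl

instance : IsScalarTower k (PreprojA3 k) (RepMod T h) where
  smul_assoc c a v := by
    rw [repMod_smul, map_smul]; rfl

lemma repMod_gen (a : PreprojGen) (v : RepMod T h) :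
    (gen k a • v : RepMod T h) = T a v := by
  rw [repMod_smul]
  have : repHom T h (gen k a) = T a := by
    unfold repHom gen
    erw [RingQuot.liftAlgHom_mkAlgHom_apply]
    simp [g]
  rw [this]

/-- The underlying vector space of a representation. -/
def RepMod.eqv : RepMod T h ≃ₗ[k] V := LinearEquiv.refl k V

@[simp] lemma eqv_gen (a : PreprojGen) (v : RepMod T h) :
    RepMod.eqv T h (gen k a • v) = T a (RepMod.eqv T h v) := by
  rw [repMod_gen]; rfl

@[simp] lemma gen_eqv_symm (a : PreprojGen) (v : V) :
    gen k a • (RepMod.eqv T h).symm v = (RepMod.eqv T h).symm (T a v) := by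
  rw [repMod_gen]; rfl

end RepMod

end Algebra


section CondSec

/-- The explicit conditions characterising `add N`. -/
def Cond (X : Type) [AddCommGroup X] [Module (PreprojA3 k) X] : Prop :=
  (∀ v : X, gen k e3 • v = v → gen k y1 • gen k y2 • v = 0 → ∃ u : X, gen k x2 • u = v) ∧
  (∀ v : X, gen k e1 • v = v → gen k x2 • gen k x1 • v = 0 → ∃ u : X, gen k y1 • u = v) ∧
  (∀ v : X, gen k e2 • v = v → gen k y1 • v = 0 → gen k x2 • v = 0 →
    ∃ u : X, gen k x1 • gen k y1 • u = v)

variable {k}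

lemma Cond.of_inAdd {M X : Type} [AddCommGroup X] [Module (PreprojA3 k) X]
    [AddCommGroup M] [Module (PreprojA3 k) M] (hM : Cond k M)
    (H : InAdd (L := PreprojA3 k) M X) : Cond k X := by
  obtain ⟨n, s, r, h⟩ := H
  obtain ⟨ha, hb, hc⟩ := hM
  refine ⟨fun v h1 h2 => ?_, fun v h1 h2 => ?_, fun v h1 h2 h3 => ?_⟩
  · have := fun i => ha (s i v) (by rw [← map_smul, h1])
      (by rw [← map_smul, ← map_smul, h2, map_zero])
    choose u hu using this
    exact ⟨∑ i, r i (u i), by simp only [Finset.smul_sum, ← map_smul, hu, h]⟩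
  · have := fun i => hb (s i v) (by rw [← map_smul, h1])
      (by rw [← map_smul, ← map_smul, h2, map_zero])
    choose u hu using this
    exact ⟨∑ i, r i (u i), by simp only [Finset.smul_sum, ← map_smul, hu, h]⟩
  · have := fun i => hc (s i v) (by rw [← map_smul, h1])
      (by rw [← map_smul, h2, map_zero]) (by rw [← map_smul, h3, map_zero])
    choose u hu using this
    exact ⟨∑ i, r i (u i), by simp only [Finset.smul_sum, ← map_smul, hu, h]⟩

lemma Cond.of_retract {M X : Type} [AddCommGroup X] [Module (PreprojA3 k) X]
    [AddCommGroup M] [Module (PreprojA3 k) M] (hM : Cond k M)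
    (s : X →ₗ[PreprojA3 k] M) (r : M →ₗ[PreprojA3 k] X) (h : ∀ x, r (s x) = x) : Cond k X :=
  hM.of_inAdd (InAdd.of_retract s r h InAdd.self)

lemma Cond.prod {X Y : Type} [AddCommGroup X] [Module (PreprojA3 k) X]
    [AddCommGroup Y] [Module (PreprojA3 k) Y] (hX : Cond k X) (hY : Cond k Y) :
    Cond k (X × Y) := by
  obtain ⟨ha, hb, hc⟩ := hX
  obtain ⟨ha', hb', hc'⟩ := hY
  refine ⟨fun v h1 h2 => ?_, fun v h1 h2 => ?_, fun v h1 h2 h3 => ?_⟩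
  · obtain ⟨u, hu⟩ := ha v.1 (congrArg Prod.fst h1) (congrArg Prod.fst h2)
    obtain ⟨u', hu'⟩ := ha' v.2 (congrArg Prod.snd h1) (congrArg Prod.snd h2)
    exact ⟨(u, u'), Prod.ext hu hu'⟩
  · obtain ⟨u, hu⟩ := hb v.1 (congrArg Prod.fst h1) (congrArg Prod.fst h2)
    obtain ⟨u', hu'⟩ := hb' v.2 (congrArg Prod.snd h1) (congrArg Prod.snd h2)
    exact ⟨(u, u'), Prod.ext hu hu'⟩
  · obtain ⟨u, hu⟩ := hc v.1 (congrArg Prod.fst h1) (congrArg Prod.fst h2)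
      (congrArg Prod.fst h3)
    obtain ⟨u', hu'⟩ := hc' v.2 (congrArg Prod.snd h1) (congrArg Prod.snd h2)
      (congrArg Prod.snd h3)
    exact ⟨(u, u'), Prod.ext hu hu'⟩

end CondSec

section Twist

variable {k} {X Y : Type} [AddCommGroup X] [Module (PreprojA3 k) X] [Module k X]
    [IsScalarTower k (PreprojA3 k) X] [AddCommGroup Y]
    [Module (PreprojA3 k) Y] [Module k Y] [IsScalarTower k (PreprojA3 k) Y]

/-- The twisted action of generators on `X × Y`. -/
def twistT (d1 d2 d3 d4 : X →ₗ[k] Y) (a : PreprojGen) : Module.End k (X × Y) :=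
  (LinearMap.prodMap (Algebra.lsmul k k X (gen k a)) (Algebra.lsmul k k Y (gen k a))) +
  (LinearMap.inr k X Y).comp (((match a with
    | x1 => d1 | y1 => d2 | x2 => d3 | y2 => d4 | _ => 0 : X →ₗ[k] Y)).comp
      (LinearMap.fst k X Y))

lemma twist (d1 d2 d3 d4 : X →ₗ[k] Y)
    (t1 : ∀ x, gen k e2 • d1 x = d1 x) (s1 : ∀ x, d1 (gen k e1 • x) = d1 x)
    (t2 : ∀ x, gen k e1 • d2 x = d2 x) (s2 : ∀ x, d2 (gen k e2 • x) = d2 x)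
    (t3 : ∀ x, gen k e3 • d3 x = d3 x) (s3 : ∀ x, d3 (gen k e2 • x) = d3 x)
    (t4 : ∀ x, gen k e2 • d4 x = d4 x) (s4 : ∀ x, d4 (gen k e3 • x) = d4 x)
    (r1 : ∀ x, gen k y1 • d1 x + d2 (gen k x1 • x) = 0)
    (r2 : ∀ x, gen k x2 • d4 x + d3 (gen k y2 • x) = 0)
    (r3 : ∀ x, gen k x1 • d2 x + d1 (gen k y1 • x) = gen k y2 • d3 x + d4 (gen k x2 • x))
    (H : ExtS (L := PreprojA3 k) X Y) :
    ∃ h : X →ₗ[k] Y,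
      (∀ x, h (gen k e1 • x) = gen k e1 • h x) ∧
      (∀ x, h (gen k e2 • x) = gen k e2 • h x) ∧
      (∀ x, h (gen k e3 • x) = gen k e3 • h x) ∧
      (∀ x, h (gen k x1 • x) + d1 x = gen k x1 • h x) ∧
      (∀ x, h (gen k y1 • x) + d2 x = gen k y1 • h x) ∧
      (∀ x, h (gen k x2 • x) + d3 x = gen k x2 • h x) ∧
      (∀ x, h (gen k y2 • x) + d4 x = gen k y2 • h x) := by
  have hrel : ∀ a b, PreprojRel k a b → FreeAlgebra.lift k (twistT d1 d2 d3 d4) a =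
      FreeAlgebra.lift k (twistT d1 d2 d3 d4) b := by
    intro a b hab
    apply LinearMap.ext
    rintro ⟨x, y⟩
    cases hab
    case sum => simp [g, twistT, act_sum]
    case rel1 => simpa [g, twistT, smul_add, add_assoc] using r1 x
    case rel2 => simpa [g, twistT, smul_add, add_assoc] using r2 x
    case rel3 => simpa [g, twistT, smul_add, add_assoc] using r3 x
    all_goals simp [g, twistT, t1, s1, t2, s2, t3, s3, t4, s4]
  let ε := RepMod.eqv (twistT d1 d2 d3 d4) hrel
  let π : RepMod (twistT d1 d2 d3 d4) hrel →ₗ[PreprojA3 k] X :=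
    mkLin ((LinearMap.fst k X Y).comp ε.toLinearMap) (by
      intro a x
      simp [ε, twistT])
  have hπ : Function.Surjective π := fun x => ⟨ε.symm (x, (0 : Y)), rfl⟩
  let f : LinearMap.ker π →ₗ[PreprojA3 k] Y :=
    mkLin (((LinearMap.snd k X Y).comp ε.toLinearMap).comp
      ((LinearMap.ker π).subtype.restrictScalars k)) (by
      rintro a ⟨z, hz⟩
      have hz' : (ε z).1 = 0 := hz
      simp [ε, twistT] at hz' ⊢
      simp [hz'])
  obtain ⟨h, hh⟩ := H _ π hπ f
  have hh' : ∀ y : Y, h (ε.symm (0, y)) = y := fun y => hh ⟨ε.symm (0, y), rfl⟩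
  let h' : X →ₗ[k] Y := ((h.restrictScalars k).comp ε.symm.toLinearMap).comp
    (LinearMap.inl k X Y)
  have key : ∀ (a : PreprojGen) (x : X) (z : Y),
      twistT d1 d2 d3 d4 a (x, 0) = (gen k a • x, z) →
      h' (gen k a • x) + z = gen k a • h' x := by
    intro a x z hz
    have e1 : gen k a • h' x = h (gen k a • ε.symm (x, 0)) := (map_smul h _ _).symm
    have e2 : ((gen k a • x, z) : X × Y) = (gen k a • x, 0) + (0, z) := by simp
    rw [e1, gen_eqv_symm, hz, e2, map_add, map_add, hh']
    rfl
  have key0 : ∀ (a : PreprojGen) (x : X),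
      twistT d1 d2 d3 d4 a (x, 0) = (gen k a • x, 0) →
      h' (gen k a • x) = gen k a • h' x := fun a x hz => by
    simpa using key a x 0 hz
  exact ⟨h', fun x => key0 _ x (by simp [twistT]), fun x => key0 _ x (by simp [twistT]),
    fun x => key0 _ x (by simp [twistT]), fun x => key _ x _ (by simp [twistT]),
    fun x => key _ x _ (by simp [twistT]), fun x => key _ x _ (by simp [twistT]),
    fun x => key _ x _ (by simp [twistT])⟩

end Twist


section Reps

variable {k}

lemma gen_smul_k {X : Type} [AddCommGroup X] [Module (PreprojA3 k) X] [Module k X]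
    [IsScalarTower k (PreprojA3 k) X] (a : PreprojGen) (c : k) (v : X) :
    gen k a • c • v = c • gen k a • v := smul_comm _ _ _

/-- Bundle generator actions as endomorphisms. -/
def mkT {V : Type} [AddCommGroup V] [Module k V] (t : PreprojGen → V → V)
    (ha : ∀ a v w, t a (v + w) = t a v + t a w)
    (hs : ∀ a (c : k) v, t a (c • v) = c • t a v) (a : PreprojGen) : Module.End k V where
  toFun := t a
  map_add' := ha a
  map_smul' := hs a

@[simp] lemma mkT_apply {V : Type} [AddCommGroup V] [Module k V] (t : PreprojGen → V → V)
    (ha : ∀ a v w, t a (v + w) = t a v + t a w)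
    (hs : ∀ a (c : k) v, t a (c • v) = c • t a v) (a : PreprojGen) (v : V) :
    mkT t ha hs a v = t a v := rfl

variable (k)

/-- action on `[2;1]` -/
def t1 : PreprojGen → k × k → k × k
  | e1, v => (0, v.2) | e2, v => (v.1, 0) | y1, v => (0, v.1)
  | e3, _ => 0 | x1, _ => 0 | x2, _ => 0 | y2, _ => 0

/-- action on `[2;3]` -/
def t2 : PreprojGen → k × k → k × k
  | e3, v => (0, v.2) | e2, v => (v.1, 0) | x2, v => (0, v.1)
  | e1, _ => 0 | x1, _ => 0 | y1, _ => 0 | y2, _ => 0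

/-- action on `[2;13]` -/
def t3 : PreprojGen → k × k × k → k × k × k
  | e1, v => (0, v.2.1, 0) | e2, v => (v.1, 0, 0) | e3, v => (0, 0, v.2.2)
  | y1, v => (0, v.1, 0) | x2, v => (0, 0, v.1)
  | x1, _ => 0 | y2, _ => 0

/-- action on `P₁` -/
def q1 : PreprojGen → k × k × k → k × k × k
  | e1, v => (v.1, 0, 0) | e2, v => (0, v.2.1, 0) | e3, v => (0, 0, v.2.2)
  | x1, v => (0, v.1, 0) | x2, v => (0, 0, v.2.1)
  | y1, _ => 0 | y2, _ => 0

/-- action on `P₂` -/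
def q2 : PreprojGen → k × k × k × k → k × k × k × k
  | e1, v => (0, v.2.1, 0, 0) | e2, v => (v.1, 0, 0, v.2.2.2) | e3, v => (0, 0, v.2.2.1, 0)
  | y1, v => (0, v.1, 0, 0) | x2, v => (0, 0, v.1, 0)
  | x1, v => (0, 0, 0, v.2.1) | y2, v => (0, 0, 0, v.2.2.1)

/-- action on `P₃` -/
def q3 : PreprojGen → k × k × k → k × k × k
  | e3, v => (v.1, 0, 0) | e2, v => (0, v.2.1, 0) | e1, v => (0, 0, v.2.2)
  | y2, v => (0, v.1, 0) | y1, v => (0, 0, v.2.1)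
  | x1, _ => 0 | x2, _ => 0

/-- action on `[2;1]`, bundled -/
def T1 : PreprojGen → Module.End k (k × k) :=
  mkT (t1 k) (by intro a; cases a <;> simp [t1]) (by intro a; cases a <;> simp [t1])
/-- action on `[2;3]`, bundled -/
def T2 : PreprojGen → Module.End k (k × k) :=
  mkT (t2 k) (by intro a; cases a <;> simp [t2]) (by intro a; cases a <;> simp [t2])
/-- action on `[2;13]`, bundled -/
def T3 : PreprojGen → Module.End k (k × k × k) :=
  mkT (t3 k) (by intro a; cases a <;> simp [t3]) (by intro a; cases a <;> simp [t3])
/-- action on `P₁`, bundled -/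
def U1 : PreprojGen → Module.End k (k × k × k) :=
  mkT (q1 k) (by intro a; cases a <;> simp [q1]) (by intro a; cases a <;> simp [q1])
/-- action on `P₂`, bundled -/
def U2 : PreprojGen → Module.End k (k × k × k × k) :=
  mkT (q2 k) (by intro a; cases a <;> simp [q2]) (by intro a; cases a <;> simp [q2])
/-- action on `P₃`, bundled -/
def U3 : PreprojGen → Module.End k (k × k × k) :=
  mkT (q3 k) (by intro a; cases a <;> simp [q3]) (by intro a; cases a <;> simp [q3])

lemma rel_T1 (a b) (h : PreprojRel k a b) :
    FreeAlgebra.lift k (T1 k) a = FreeAlgebra.lift k (T1 k) b := by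
  apply LinearMap.ext; rintro ⟨p, q⟩; cases h <;> simp [g, T1, t1]
lemma rel_T2 (a b) (h : PreprojRel k a b) :
    FreeAlgebra.lift k (T2 k) a = FreeAlgebra.lift k (T2 k) b := by
  apply LinearMap.ext; rintro ⟨p, q⟩; cases h <;> simp [g, T2, t2]
lemma rel_T3 (a b) (h : PreprojRel k a b) :
    FreeAlgebra.lift k (T3 k) a = FreeAlgebra.lift k (T3 k) b := by
  apply LinearMap.ext; rintro ⟨p, q, r⟩; cases h <;> simp [g, T3, t3]
lemma rel_U1 (a b) (h : PreprojRel k a b) :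
    FreeAlgebra.lift k (U1 k) a = FreeAlgebra.lift k (U1 k) b := by
  apply LinearMap.ext; rintro ⟨p, q, r⟩; cases h <;> simp [g, U1, q1]
lemma rel_U2 (a b) (h : PreprojRel k a b) :
    FreeAlgebra.lift k (U2 k) a = FreeAlgebra.lift k (U2 k) b := by
  apply LinearMap.ext; rintro ⟨p, q, r, s⟩; cases h <;> simp [g, U2, q2]
lemma rel_U3 (a b) (h : PreprojRel k a b) :
    FreeAlgebra.lift k (U3 k) a = FreeAlgebra.lift k (U3 k) b := by
  apply LinearMap.ext; rintro ⟨p, q, r⟩; cases h <;> simp [g, U3, q3]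
  rfl

/-- concrete `[2;1]` -/
abbrev R1 : Type := RepMod (T1 k) (rel_T1 k)
/-- concrete `[2;3]` -/
abbrev R2 : Type := RepMod (T2 k) (rel_T2 k)
/-- concrete `[2;13]` -/
abbrev R3 : Type := RepMod (T3 k) (rel_T3 k)
/-- concrete `P₁` -/
abbrev Q1 : Type := RepMod (U1 k) (rel_U1 k)
/-- concrete `P₂` -/
abbrev Q2 : Type := RepMod (U2 k) (rel_U2 k)
/-- concrete `P₃` -/
abbrev Q3 : Type := RepMod (U3 k) (rel_U3 k)

/-- coordinates -/
abbrev E1 : R1 k ≃ₗ[k] k × k := RepMod.eqv (T1 k) (rel_T1 k)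
/-- coordinates -/
abbrev E2 : R2 k ≃ₗ[k] k × k := RepMod.eqv (T2 k) (rel_T2 k)
/-- coordinates -/
abbrev E3 : R3 k ≃ₗ[k] k × k × k := RepMod.eqv (T3 k) (rel_T3 k)
/-- coordinates -/
abbrev F1 : Q1 k ≃ₗ[k] k × k × k := RepMod.eqv (U1 k) (rel_U1 k)
/-- coordinates -/
abbrev F2 : Q2 k ≃ₗ[k] k × k × k × k := RepMod.eqv (U2 k) (rel_U2 k)
/-- coordinates -/
abbrev F3 : Q3 k ≃ₗ[k] k × k × k := RepMod.eqv (U3 k) (rel_U3 k)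

lemma T1_apply (a : PreprojGen) (v) : T1 k a v = t1 k a v := rfl
lemma T2_apply (a : PreprojGen) (v) : T2 k a v = t2 k a v := rfl
lemma T3_apply (a : PreprojGen) (v) : T3 k a v = t3 k a v := rfl
lemma U1_apply (a : PreprojGen) (v) : U1 k a v = q1 k a v := rfl
lemma U2_apply (a : PreprojGen) (v) : U2 k a v = q2 k a v := rfl
lemma U3_apply (a : PreprojGen) (v) : U3 k a v = q3 k a v := rfl

section cond

lemma zero_eq' {M : Type} [AddCommGroup M] (a : M) : (0 : M) = a ↔ a = 0 := eq_comm


lemma cond_R1 : Cond k (R1 k) := by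
  refine ⟨fun v h1 h2 => ?_, fun v h1 h2 => ?_, fun v h1 h2 h3 => ?_⟩
  all_goals obtain ⟨⟨p, q⟩, rfl⟩ := (E1 k).symm.surjective v
  · simp [zero_eq', T1_apply, t1] at h1 h2
    exact ⟨0, by simp [zero_eq', h1]⟩
  · simp [zero_eq', T1_apply, t1] at h1 h2
    exact ⟨(E1 k).symm (q, 0), by simp [zero_eq', T1_apply, t1, h1]⟩
  · simp [zero_eq', T1_apply, t1] at h1 h2 h3
    exact ⟨0, by simp [zero_eq', h1, h2]⟩

lemma cond_R2 : Cond k (R2 k) := by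
  refine ⟨fun v h1 h2 => ?_, fun v h1 h2 => ?_, fun v h1 h2 h3 => ?_⟩
  all_goals obtain ⟨⟨p, q⟩, rfl⟩ := (E2 k).symm.surjective v
  · simp [zero_eq', T2_apply, t2] at h1 h2
    exact ⟨(E2 k).symm (q, 0), by simp [zero_eq', T2_apply, t2, h1]⟩
  · simp [zero_eq', T2_apply, t2] at h1 h2
    exact ⟨0, by simp [zero_eq', h1]⟩
  · simp [zero_eq', T2_apply, t2] at h1 h2 h3
    exact ⟨0, by simp [zero_eq', h1, h3]⟩

lemma cond_R3 : Cond k (R3 k) := by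
  refine ⟨fun v h1 h2 => ?_, fun v h1 h2 => ?_, fun v h1 h2 h3 => ?_⟩
  all_goals obtain ⟨⟨p, q, r⟩, rfl⟩ := (E3 k).symm.surjective v
  · simp [zero_eq', T3_apply, t3] at h1 h2
    exact ⟨(E3 k).symm (r, 0, 0), by simp [zero_eq', T3_apply, t3, h1]⟩
  · simp [zero_eq', T3_apply, t3] at h1 h2
    exact ⟨(E3 k).symm (q, 0, 0), by simp [zero_eq', T3_apply, t3, h1]⟩
  · simp [zero_eq', T3_apply, t3] at h1 h2 h3
    exact ⟨0, by simp [zero_eq', h1, h3]⟩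

lemma cond_Q1 : Cond k (Q1 k) := by
  refine ⟨fun v h1 h2 => ?_, fun v h1 h2 => ?_, fun v h1 h2 h3 => ?_⟩
  all_goals obtain ⟨⟨p, q, r⟩, rfl⟩ := (F1 k).symm.surjective v
  · simp [zero_eq', U1_apply, q1] at h1 h2
    exact ⟨(F1 k).symm (0, r, 0), by simp [zero_eq', U1_apply, q1, h1]⟩
  · simp [zero_eq', U1_apply, q1] at h1 h2
    exact ⟨0, by simp [zero_eq', h1, h2]⟩
  · simp [zero_eq', U1_apply, q1] at h1 h2 h3
    exact ⟨0, by simp [zero_eq', h1, h3]⟩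

lemma cond_Q2 : Cond k (Q2 k) := by
  refine ⟨fun v h1 h2 => ?_, fun v h1 h2 => ?_, fun v h1 h2 h3 => ?_⟩
  all_goals obtain ⟨⟨p, q, r, s⟩, rfl⟩ := (F2 k).symm.surjective v
  · simp [zero_eq', U2_apply, q2] at h1 h2
    exact ⟨(F2 k).symm (r, 0, 0, 0), by simp [zero_eq', U2_apply, q2, h1]⟩
  · simp [zero_eq', U2_apply, q2] at h1 h2
    exact ⟨(F2 k).symm (q, 0, 0, 0), by simp [zero_eq', U2_apply, q2, h1]⟩
  · simp [zero_eq', U2_apply, q2] at h1 h2 h3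
    exact ⟨(F2 k).symm (s, 0, 0, 0), by simp [zero_eq', U2_apply, q2, h1, h2]⟩

lemma cond_Q3 : Cond k (Q3 k) := by
  refine ⟨fun v h1 h2 => ?_, fun v h1 h2 => ?_, fun v h1 h2 h3 => ?_⟩
  all_goals obtain ⟨⟨p, q, r⟩, rfl⟩ := (F3 k).symm.surjective v
  · simp [zero_eq', U3_apply, q3] at h1 h2
    exact ⟨0, by simp [zero_eq', h1, h2]⟩
  · simp [zero_eq', U3_apply, q3] at h1 h2
    exact ⟨(F3 k).symm (0, r, 0), by simp [zero_eq', U3_apply, q3, h1]⟩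
  · simp [zero_eq', U3_apply, q3] at h1 h2 h3
    exact ⟨0, by simp [zero_eq', h1, h2]⟩

end cond

section maps

variable {k} {X : Type} [AddCommGroup X] [Module (PreprojA3 k) X]

lemma kills1 {v : X} (h : gen k e1 • v = v) : gen k e2 • v = 0 ∧ gen k e3 • v = 0 ∧
    gen k y1 • v = 0 ∧ gen k x2 • v = 0 ∧ gen k y2 • v = 0 := by
  rw [← h]; simp
lemma kills2 {v : X} (h : gen k e2 • v = v) : gen k e1 • v = 0 ∧ gen k e3 • v = 0 ∧
    gen k x1 • v = 0 ∧ gen k y2 • v = 0 := by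
  rw [← h]; simp
lemma kills3 {v : X} (h : gen k e3 • v = v) : gen k e1 • v = 0 ∧ gen k e2 • v = 0 ∧
    gen k x1 • v = 0 ∧ gen k y1 • v = 0 ∧ gen k x2 • v = 0 := by
  rw [← h]; simp

variable [Module k X] [IsScalarTower k (PreprojA3 k) X]

lemma from_R1 (v : X) (h : gen k e2 • v = v) (h' : gen k x2 • v = 0) :
    ∃ φ : R1 k →ₗ[PreprojA3 k] X, ∀ p q, φ ((E1 k).symm (p, q)) = p • v + q • gen k y1 • v := by
  have w : gen k x1 • gen k y1 • v = 0 := by rw [← act_y2x2, h', smul_zero]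
  refine ⟨mkLin (((LinearMap.fst k k k).smulRight v +
    (LinearMap.snd k k k).smulRight (gen k y1 • v)) ∘ₗ (E1 k).toLinearMap) ?_, fun p q => ?_⟩
  · intro a z
    obtain ⟨⟨p, q⟩, rfl⟩ := (E1 k).symm.surjective z
    obtain ⟨k1, k2, k3, k4⟩ := kills2 h
    cases a <;> simp [T1_apply, t1, smul_add, gen_smul_k, h, k1, k2, k3, k4, h', w]
  · simp

lemma from_R2 (v : X) (h : gen k e2 • v = v) (h' : gen k y1 • v = 0) :
    ∃ φ : R2 k →ₗ[PreprojA3 k] X, ∀ p q, φ ((E2 k).symm (p, q)) = p • v + q • gen k x2 • v := by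
  refine ⟨mkLin (((LinearMap.fst k k k).smulRight v +
    (LinearMap.snd k k k).smulRight (gen k x2 • v)) ∘ₗ (E2 k).toLinearMap) ?_, fun p q => ?_⟩
  · intro a z
    obtain ⟨⟨p, q⟩, rfl⟩ := (E2 k).symm.surjective z
    obtain ⟨k1, k2, k3, k4⟩ := kills2 h
    cases a <;> simp [T2_apply, t2, smul_add, gen_smul_k, h, k1, k2, k3, k4, h']
  · simp

lemma from_R3 (v : X) (h : gen k e2 • v = v) (h' : gen k x1 • gen k y1 • v = 0) :
    ∃ φ : R3 k →ₗ[PreprojA3 k] X, ∀ p q r, φ ((E3 k).symm (p, q, r)) =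
      p • v + q • gen k y1 • v + r • gen k x2 • v := by
  refine ⟨mkLin (((LinearMap.fst k k (k × k)).smulRight v +
    (LinearMap.fst k k k ∘ₗ LinearMap.snd k k (k × k)).smulRight (gen k y1 • v) +
    (LinearMap.snd k k k ∘ₗ LinearMap.snd k k (k × k)).smulRight (gen k x2 • v))
      ∘ₗ (E3 k).toLinearMap) ?_, fun p q r => ?_⟩
  · intro a z
    obtain ⟨⟨p, q, r⟩, rfl⟩ := (E3 k).symm.surjective z
    obtain ⟨k1, k2, k3, k4⟩ := kills2 h
    cases a <;> simp [T3_apply, t3, smul_add, gen_smul_k, h, k1, k2, k3, k4, h']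
  · simp

lemma from_Q1 (v : X) (h : gen k e1 • v = v) :
    ∃ φ : Q1 k →ₗ[PreprojA3 k] X, ∀ p q r, φ ((F1 k).symm (p, q, r)) =
      p • v + q • gen k x1 • v + r • gen k x2 • gen k x1 • v := by
  refine ⟨mkLin (((LinearMap.fst k k (k × k)).smulRight v +
    (LinearMap.fst k k k ∘ₗ LinearMap.snd k k (k × k)).smulRight (gen k x1 • v) +
    (LinearMap.snd k k k ∘ₗ LinearMap.snd k k (k × k)).smulRight (gen k x2 • gen k x1 • v))
      ∘ₗ (F1 k).toLinearMap) ?_, fun p q r => ?_⟩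
  · intro a z
    obtain ⟨⟨p, q, r⟩, rfl⟩ := (F1 k).symm.surjective z
    obtain ⟨k1, k2, k3, k4, k5⟩ := kills1 h
    cases a <;> simp [U1_apply, q1, smul_add, gen_smul_k, h, k1, k2, k3, k4, k5]
  · simp

lemma from_Q3 (v : X) (h : gen k e3 • v = v) :
    ∃ φ : Q3 k →ₗ[PreprojA3 k] X, ∀ p q r, φ ((F3 k).symm (p, q, r)) =
      p • v + q • gen k y2 • v + r • gen k y1 • gen k y2 • v := by
  refine ⟨mkLin (((LinearMap.fst k k (k × k)).smulRight v +
    (LinearMap.fst k k k ∘ₗ LinearMap.snd k k (k × k)).smulRight (gen k y2 • v) +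
    (LinearMap.snd k k k ∘ₗ LinearMap.snd k k (k × k)).smulRight (gen k y1 • gen k y2 • v))
      ∘ₗ (F3 k).toLinearMap) ?_, fun p q r => ?_⟩
  · intro a z
    obtain ⟨⟨p, q, r⟩, rfl⟩ := (F3 k).symm.surjective z
    obtain ⟨k1, k2, k3, k4, k5⟩ := kills3 h
    cases a <;> simp [U3_apply, q3, smul_add, gen_smul_k, h, k1, k2, k3, k4, k5]
  · simp

lemma from_Q2 (v : X) (h : gen k e2 • v = v) :
    ∃ φ : Q2 k →ₗ[PreprojA3 k] X, ∀ p q r s, φ ((F2 k).symm (p, q, r, s)) =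
      p • v + q • gen k y1 • v + r • gen k x2 • v + s • gen k x1 • gen k y1 • v := by
  refine ⟨mkLin (((LinearMap.fst k k (k × k × k)).smulRight v +
    (LinearMap.fst k k (k × k) ∘ₗ LinearMap.snd k k (k × k × k)).smulRight (gen k y1 • v) +
    (LinearMap.fst k k k ∘ₗ LinearMap.snd k k (k × k) ∘ₗ
      LinearMap.snd k k (k × k × k)).smulRight (gen k x2 • v) +
    (LinearMap.snd k k k ∘ₗ LinearMap.snd k k (k × k) ∘ₗ
      LinearMap.snd k k (k × k × k)).smulRight (gen k x1 • gen k y1 • v))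
      ∘ₗ (F2 k).toLinearMap) ?_, fun p q r s => ?_⟩
  · intro a z
    obtain ⟨⟨p, q, r, s⟩, rfl⟩ := (F2 k).symm.surjective z
    obtain ⟨k1, k2, k3, k4⟩ := kills2 h
    cases a <;> simp [U2_apply, q2, smul_add, gen_smul_k, h, k1, k2, k3, k4]
  · simp

end maps

end Reps


section Quot

instance instP2Quotk (w : PreprojA3 k) : Module k (P2Quot k w) :=
  Module.compHom _ (algebraMap k (PreprojA3 k))

instance (w : PreprojA3 k) : IsScalarTower k (PreprojA3 k) (P2Quot k w) :=
  IsScalarTower.of_algebraMap_smul fun _ _ => rfl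

variable {k}

/-- the projection onto the quotient -/
def p2mk (w : PreprojA3 k) : P2 k →ₗ[PreprojA3 k] P2Quot k w :=
  Submodule.mkQ ((Submodule.span (PreprojA3 k) {w}).comap (P2 k).subtype)

lemma p2mk_surj (w : PreprojA3 k) : Function.Surjective (p2mk w) :=
  Submodule.mkQ_surjective _

lemma p2mk_ker (w : PreprojA3 k) (z : P2 k) :
    p2mk w z = 0 ↔ ∃ a : PreprojA3 k, a * w = z := by
  have : p2mk w z = 0 ↔ z ∈ (Submodule.span (PreprojA3 k) {w}).comap (P2 k).subtype :=
    Submodule.Quotient.mk_eq_zero _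
  rw [this, Submodule.mem_comap, Submodule.mem_span_singleton]
  rfl

lemma mem_P2 (a : PreprojA3 k) : a ∈ P2 k ↔ a * gen k e2 = a := by
  unfold P2
  rw [Submodule.mem_span_singleton]
  constructor
  · rintro ⟨b, rfl⟩
    rw [smul_eq_mul, mul_assoc]
    congr 1
    exact gen_src k e2
  · intro h
    exact ⟨a, h⟩

variable (k) in
/-- the generator of `P₂` -/
def p2gen : P2 k := ⟨gen k e2, (mem_P2 _).2 (gen_src k e2)⟩

lemma p2_eq (z : P2 k) : z = (z : PreprojA3 k) • p2gen k :=
  Subtype.ext ((mem_P2 _).1 z.2).symm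

/-- generator of the quotient -/
def ep (w : PreprojA3 k) : P2Quot k w := p2mk w (p2gen k)

lemma ep_span (w : PreprojA3 k) (x : P2Quot k w) : ∃ a : PreprojA3 k, x = a • ep w := by
  obtain ⟨z, rfl⟩ := p2mk_surj w x
  exact ⟨z, by rw [ep, ← map_smul, ← p2_eq]⟩

lemma ep_e2 (w : PreprojA3 k) : gen k e2 • ep w = ep w := by
  rw [ep, ← map_smul]
  congr 1
  exact Subtype.ext (gen_src k e2)

lemma ep_w (w : PreprojA3 k) (hw : w * gen k e2 = w) : w • ep w = 0 := by
  rw [ep, ← map_smul, p2mk_ker]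
  exact ⟨1, by rw [one_mul]; exact hw.symm⟩

lemma ep_lift {X : Type} [AddCommGroup X] [Module (PreprojA3 k) X] (w : PreprojA3 k) (z : X)
    (h : gen k e2 • z = z) (h' : w • z = 0) :
    ∃ φ : P2Quot k w →ₗ[PreprojA3 k] X, φ (ep w) = z := by
  refine ⟨Submodule.liftQ _ ((LinearMap.toSpanSingleton (PreprojA3 k) X z).comp (P2 k).subtype)
    ?_, ?_⟩
  · intro p hp
    obtain ⟨a, ha⟩ := Submodule.mem_span_singleton.1 (Submodule.mem_comap.1 hp)
    rw [LinearMap.mem_ker, LinearMap.comp_apply, ← ha, LinearMap.toSpanSingleton_apply,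
      smul_eq_mul, mul_smul, h', smul_zero]
  · exact h

instance : Module.Projective (PreprojA3 k) (P2 k) := by
  refine Module.Projective.of_split (M := PreprojA3 k) (P2 k).subtype
    (LinearMap.toSpanSingleton (PreprojA3 k) (P2 k) (p2gen k)) ?_
  ext z
  exact (mem_P2 _).1 z.2

lemma extS_P2Quot {Y : Type} [AddCommGroup Y] [Module (PreprojA3 k) Y] (w : PreprojA3 k)
    (hw : w * gen k e2 = w)
    (H : ∀ v : Y, (∀ a : PreprojA3 k, a * w = 0 → a • v = 0) → ∃ u : Y, w • u = v) :
    ExtS (L := PreprojA3 k) (P2Quot k w) Y := by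
  refine extS_of_proj (p2mk w) (fun f => ?_) (p2mk_surj w)
  have hk : p2mk w ⟨w, (mem_P2 _).2 hw⟩ = 0 := (p2mk_ker w _).2 ⟨1, one_mul _⟩
  let W : LinearMap.ker (p2mk w) := ⟨⟨w, (mem_P2 _).2 hw⟩, hk⟩
  obtain ⟨u, hu⟩ := H (f W) (fun a ha => by
    rw [← map_smul]
    have : a • W = 0 := Subtype.ext (Subtype.ext ha)
    rw [this, map_zero])
  refine ⟨(LinearMap.toSpanSingleton (PreprojA3 k) Y u).comp (P2 k).subtype, fun z => ?_⟩
  obtain ⟨a, ha⟩ := (p2mk_ker w _).1 z.2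
  have hz : z = a • W := Subtype.ext (Subtype.ext ha.symm)
  rw [hz, map_smul, ← hu, ← mul_smul]
  rfl

lemma extS_N {Y : Type} [AddCommGroup Y] [Module (PreprojA3 k) Y] (hY : Cond k Y) :
    ExtS (L := PreprojA3 k) (NN k) Y := by
  have h1 : ExtS (L := PreprojA3 k) (P2Quot k (gen k x2)) Y := by
    refine extS_P2Quot _ (gen_src k x2) fun v hv => hY.1 v ?_ ?_
    · have := hv (gen k e3 - 1) (by rw [sub_mul, one_mul, sub_eq_zero]; exact gen_tgt k x2)
      rwa [sub_smul, one_smul, sub_eq_zero] at this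
    · rw [← mul_smul]
      refine hv _ ?_
      rw [mul_assoc, gen_rel3, ← mul_assoc, gen_rel1, zero_mul]
  have h2 : ExtS (L := PreprojA3 k) (P2Quot k (gen k y1)) Y := by
    refine extS_P2Quot _ (gen_src k y1) fun v hv => hY.2.1 v ?_ ?_
    · have := hv (gen k e1 - 1) (by rw [sub_mul, one_mul, sub_eq_zero]; exact gen_tgt k y1)
      rwa [sub_smul, one_smul, sub_eq_zero] at this
    · rw [← mul_smul]
      refine hv _ ?_
      rw [mul_assoc, ← gen_rel3, ← mul_assoc, gen_rel2, zero_mul]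
  have h3 : ExtS (L := PreprojA3 k) (P2Quot k (gen k x1 * gen k y1)) Y := by
    refine extS_P2Quot _ (by rw [mul_assoc]; congr 1; exact gen_src k y1) fun v hv => ?_
    have k1 : gen k e2 • v = v := by
      have := hv (gen k e2 - 1) (by
        rw [sub_mul, one_mul, sub_eq_zero, ← mul_assoc]; congr 1; exact gen_tgt k x1)
      rwa [sub_smul, one_smul, sub_eq_zero] at this
    obtain ⟨u, hu⟩ := hY.2.2 v k1 (hv _ (by rw [← mul_assoc, gen_rel1, zero_mul]))
      (hv _ (by rw [← gen_rel3, ← mul_assoc, gen_rel2, zero_mul]))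
    exact ⟨u, by rw [mul_smul, hu]⟩
  exact (extS_of_projective (X := PreprojA3 k)).prod (h1.prod (h2.prod h3))

/-- Retract relation. -/
def Retr (X M : Type) [AddCommGroup X] [Module (PreprojA3 k) X] [AddCommGroup M]
    [Module (PreprojA3 k) M] : Prop :=
  ∃ (s : X →ₗ[PreprojA3 k] M) (r : M →ₗ[PreprojA3 k] X), ∀ x, r (s x) = x

lemma Retr.trans {X M M' : Type} [AddCommGroup X] [Module (PreprojA3 k) X] [AddCommGroup M]
    [Module (PreprojA3 k) M] [AddCommGroup M'] [Module (PreprojA3 k) M']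
    (h : Retr (k := k) X M) (h' : Retr (k := k) M M') : Retr (k := k) X M' := by
  obtain ⟨s, r, h⟩ := h
  obtain ⟨s', r', h'⟩ := h'
  exact ⟨s'.comp s, r.comp r', fun x => by simp [h, h']⟩

lemma Retr.fst {X Y : Type} [AddCommGroup X] [Module (PreprojA3 k) X] [AddCommGroup Y]
    [Module (PreprojA3 k) Y] : Retr (k := k) X (X × Y) :=
  ⟨LinearMap.inl _ _ _, LinearMap.fst _ _ _, fun _ => rfl⟩

lemma Retr.snd {X Y : Type} [AddCommGroup X] [Module (PreprojA3 k) X] [AddCommGroup Y]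
    [Module (PreprojA3 k) Y] : Retr (k := k) Y (X × Y) :=
  ⟨LinearMap.inr _ _ _, LinearMap.snd _ _ _, fun _ => rfl⟩

lemma Cond.of_retr {X M : Type} [AddCommGroup X] [Module (PreprojA3 k) X] [AddCommGroup M]
    [Module (PreprojA3 k) M] (h : Retr (k := k) X M) (hM : Cond k M) : Cond k X := by
  obtain ⟨s, r, h⟩ := h
  exact hM.of_retract s r h

lemma InAdd.of_retr {X M : Type} [AddCommGroup X] [Module (PreprojA3 k) X] [AddCommGroup M]
    [Module (PreprojA3 k) M] (h : Retr (k := k) X M) : InAdd (L := PreprojA3 k) M X := by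
  obtain ⟨s, r, h⟩ := h
  exact InAdd.of_retract s r h InAdd.self

/-- Two modules generated by corresponding elements. -/
lemma iso_aux {X : Type} [AddCommGroup X] [Module (PreprojA3 k) X] (w : PreprojA3 k) (z : X)
    (h : gen k e2 • z = z) (h' : w • z = 0) (φ : X →ₗ[PreprojA3 k] P2Quot k w)
    (hφ : φ z = ep w) (hz : ∀ ψ : X →ₗ[PreprojA3 k] X, ψ z = z → ∀ x, ψ x = x) :
    Retr (k := k) X (P2Quot k w) ∧ Retr (k := k) (P2Quot k w) X := by
  obtain ⟨ψ, hψ⟩ := ep_lift w z h h'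
  refine ⟨⟨φ, ψ, hz (ψ.comp φ) (by simp [hφ, hψ])⟩, ⟨ψ, φ, fun x => ?_⟩⟩
  obtain ⟨a, rfl⟩ := ep_span w x
  rw [map_smul, map_smul, hψ, hφ]

variable (k)

/-- generator -/
abbrev z1 : R1 k := (E1 k).symm (1, 0)
/-- generator -/
abbrev z2 : R2 k := (E2 k).symm (1, 0)
/-- generator -/
abbrev z3 : R3 k := (E3 k).symm (1, 0, 0)

lemma iso1 : Retr (k := k) (R1 k) (P2Quot k (gen k x2)) ∧
    Retr (k := k) (P2Quot k (gen k x2)) (R1 k) := by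
  obtain ⟨φ, hφ⟩ := from_R1 (ep (gen k x2)) (ep_e2 _) (ep_w _ (gen_src k x2))
  refine iso_aux _ (z1 k) (by simp [T1_apply, t1]) (by simp [T1_apply, t1]) φ
    (by rw [hφ]; simp) fun ψ hψ x => ?_
  obtain ⟨⟨p, q⟩, rfl⟩ := (E1 k).symm.surjective x
  have : (E1 k).symm (p, q) = algebraMap k (PreprojA3 k) p • z1 k +
      algebraMap k (PreprojA3 k) q • gen k y1 • z1 k := by
    simp [T1_apply, t1, ← map_smul, ← map_add]
  rw [this, map_add, map_smul, map_smul, map_smul, hψ]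

lemma iso2 : Retr (k := k) (R2 k) (P2Quot k (gen k y1)) ∧
    Retr (k := k) (P2Quot k (gen k y1)) (R2 k) := by
  obtain ⟨φ, hφ⟩ := from_R2 (ep (gen k y1)) (ep_e2 _) (ep_w _ (gen_src k y1))
  refine iso_aux _ (z2 k) (by simp [T2_apply, t2]) (by simp [T2_apply, t2]) φ
    (by rw [hφ]; simp) fun ψ hψ x => ?_
  obtain ⟨⟨p, q⟩, rfl⟩ := (E2 k).symm.surjective x
  have : (E2 k).symm (p, q) = algebraMap k (PreprojA3 k) p • z2 k +
      algebraMap k (PreprojA3 k) q • gen k x2 • z2 k := by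
    simp [T2_apply, t2, ← map_smul, ← map_add]
  rw [this, map_add, map_smul, map_smul, map_smul, hψ]

lemma iso3 : Retr (k := k) (R3 k) (P2Quot k (gen k x1 * gen k y1)) ∧
    Retr (k := k) (P2Quot k (gen k x1 * gen k y1)) (R3 k) := by
  have hw : gen k x1 * gen k y1 * gen k e2 = gen k x1 * gen k y1 := by
    rw [mul_assoc]; congr 1; exact gen_src k y1
  obtain ⟨φ, hφ⟩ := from_R3 (ep (gen k x1 * gen k y1)) (ep_e2 _)
    (by rw [← mul_smul]; exact ep_w _ hw)
  refine iso_aux _ (z3 k) (by simp [T3_apply, t3]) (by rw [mul_smul]; simp [T3_apply, t3]) φ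
    (by rw [hφ]; simp) fun ψ hψ x => ?_
  obtain ⟨⟨p, q, r⟩, rfl⟩ := (E3 k).symm.surjective x
  have : (E3 k).symm (p, q, r) = algebraMap k (PreprojA3 k) p • z3 k +
      algebraMap k (PreprojA3 k) q • gen k y1 • z3 k +
      algebraMap k (PreprojA3 k) r • gen k x2 • z3 k := by
    simp [T3_apply, t3, ← map_smul, ← map_add]
  rw [this, map_add, map_add, map_smul, map_smul, map_smul, map_smul, map_smul, hψ]

lemma A_retr : Retr (k := k) (PreprojA3 k) (Q1 k × Q2 k × Q3 k) := by
  obtain ⟨φ1, h1⟩ := from_Q1 (k := k) (gen k e1) (gen_src k e1)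
  obtain ⟨φ2, h2⟩ := from_Q2 (k := k) (gen k e2) (gen_src k e2)
  obtain ⟨φ3, h3⟩ := from_Q3 (k := k) (gen k e3) (gen_src k e3)
  refine ⟨LinearMap.toSpanSingleton _ _ ((F1 k).symm (1, 0, 0), (F2 k).symm (1, 0, 0, 0),
    (F3 k).symm (1, 0, 0)), φ1.coprod (φ2.coprod φ3), fun x => ?_⟩
  rw [LinearMap.toSpanSingleton_apply, map_smul, LinearMap.coprod_apply, LinearMap.coprod_apply]
  simp only [h1, h2, h3]
  simp [← add_assoc, gen_sum]

lemma retr_gen {X : Type} [AddCommGroup X] [Module (PreprojA3 k) X] (z : X)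
    (φ : X →ₗ[PreprojA3 k] PreprojA3 k) (h : φ z • z = z)
    (hz : ∀ ψ : X →ₗ[PreprojA3 k] X, ψ z = z → ∀ x, ψ x = x) :
    Retr (k := k) X (PreprojA3 k) :=
  ⟨φ, LinearMap.toSpanSingleton _ _ z, hz ((LinearMap.toSpanSingleton _ _ z).comp φ) h⟩

lemma Q1_retr : Retr (k := k) (Q1 k) (PreprojA3 k) := by
  obtain ⟨φ, hφ⟩ := from_Q1 (k := k) (gen k e1) (gen_src k e1)
  refine retr_gen k ((F1 k).symm (1, 0, 0)) φ (by rw [hφ]; simp [U1_apply, q1]) fun ψ hψ x => ?_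
  obtain ⟨⟨p, q, r⟩, rfl⟩ := (F1 k).symm.surjective x
  have : (F1 k).symm (p, q, r) = algebraMap k (PreprojA3 k) p • (F1 k).symm (1, 0, 0) +
      algebraMap k (PreprojA3 k) q • gen k x1 • (F1 k).symm (1, 0, 0) +
      algebraMap k (PreprojA3 k) r • gen k x2 • gen k x1 • (F1 k).symm (1, 0, 0) := by
    simp [U1_apply, q1, ← map_smul, ← map_add]
  rw [this]
  simp only [map_add, map_smul, hψ]

lemma Q3_retr : Retr (k := k) (Q3 k) (PreprojA3 k) := by
  obtain ⟨φ, hφ⟩ := from_Q3 (k := k) (gen k e3) (gen_src k e3)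
  refine retr_gen k ((F3 k).symm (1, 0, 0)) φ (by rw [hφ]; simp [U3_apply, q3]) fun ψ hψ x => ?_
  obtain ⟨⟨p, q, r⟩, rfl⟩ := (F3 k).symm.surjective x
  have : (F3 k).symm (p, q, r) = algebraMap k (PreprojA3 k) p • (F3 k).symm (1, 0, 0) +
      algebraMap k (PreprojA3 k) q • gen k y2 • (F3 k).symm (1, 0, 0) +
      algebraMap k (PreprojA3 k) r • gen k y1 • gen k y2 • (F3 k).symm (1, 0, 0) := by
    simp [U3_apply, q3, ← map_smul, ← map_add]
  rw [this]
  simp only [map_add, map_smul, hψ]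

lemma Q2_retr : Retr (k := k) (Q2 k) (PreprojA3 k) := by
  obtain ⟨φ, hφ⟩ := from_Q2 (k := k) (gen k e2) (gen_src k e2)
  refine retr_gen k ((F2 k).symm (1, 0, 0, 0)) φ (by rw [hφ]; simp [U2_apply, q2])
    fun ψ hψ x => ?_
  obtain ⟨⟨p, q, r, s⟩, rfl⟩ := (F2 k).symm.surjective x
  have : (F2 k).symm (p, q, r, s) = algebraMap k (PreprojA3 k) p • (F2 k).symm (1, 0, 0, 0) +
      algebraMap k (PreprojA3 k) q • gen k y1 • (F2 k).symm (1, 0, 0, 0) +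
      algebraMap k (PreprojA3 k) r • gen k x2 • (F2 k).symm (1, 0, 0, 0) +
      algebraMap k (PreprojA3 k) s • gen k x1 • gen k y1 • (F2 k).symm (1, 0, 0, 0) := by
    simp [U2_apply, q2, ← map_smul, ← map_add]
  rw [this]
  simp only [map_add, map_smul, hψ]

lemma cond_A : Cond k (PreprojA3 k) :=
  Cond.of_retr (A_retr k) ((cond_Q1 k).prod ((cond_Q2 k).prod (cond_Q3 k)))

lemma cond_NN : Cond k (NN k) :=
  (cond_A k).prod ((Cond.of_retr (iso1 k).2 (cond_R1 k)).prod
    ((Cond.of_retr (iso2 k).2 (cond_R2 k)).prod (Cond.of_retr (iso3 k).2 (cond_R3 k))))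

lemma A_NN : Retr (k := k) (PreprojA3 k) (NN k) := Retr.fst
lemma R1_NN : Retr (k := k) (R1 k) (NN k) :=
  (iso1 k).1.trans (Retr.trans (M := N1 k × N2 k × N3 k) Retr.fst Retr.snd)
lemma R2_NN : Retr (k := k) (R2 k) (NN k) :=
  (iso2 k).1.trans (Retr.trans (M := N1 k × N2 k × N3 k)
    (Retr.trans (M := N2 k × N3 k) Retr.fst Retr.snd) Retr.snd)
lemma R3_NN : Retr (k := k) (R3 k) (NN k) :=
  (iso3 k).1.trans (Retr.trans (M := N1 k × N2 k × N3 k)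
    (Retr.trans (M := N2 k × N3 k) Retr.snd Retr.snd) Retr.snd)

instance finA : Module.Finite k (PreprojA3 k) := by
  obtain ⟨s, r, h⟩ := A_retr k
  have : Module.Finite k (Q1 k × Q2 k × Q3 k) :=
    Module.Finite.equiv ((F1 k).prodCongr ((F2 k).prodCongr (F3 k))).symm
  refine Module.Finite.of_injective (s.restrictScalars k) ?_
  exact Function.LeftInverse.injective h

instance finQ (w : PreprojA3 k) : Module.Finite (PreprojA3 k) (P2Quot k w) :=
  have : Module.Finite (PreprojA3 k) (P2 k) := by unfold P2; infer_instance
  Module.Finite.of_surjective (p2mk w) (p2mk_surj w)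

lemma finNN : Module.Finite (PreprojA3 k) (NN k) :=
  inferInstanceAs (Module.Finite (PreprojA3 k) (PreprojA3 k × P2Quot k _ × P2Quot k _ × P2Quot k _))

end Quot


section ExtToCond

variable {k}

lemma exists_fun {X : Type} [AddCommGroup X] [Module k X] (S : Submodule k X) (v : X) (hv : v ∉ S) :
    ∃ f : X →ₗ[k] k, f v = 1 ∧ ∀ s ∈ S, f s = 0 := by
  obtain ⟨f, hf, hS⟩ := Submodule.exists_le_ker_of_notMem hv
  refine ⟨(f v)⁻¹ • f, by simp [hf], fun s hs => ?_⟩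
  have : f s = 0 := hS hs
  simp [this]

variable {X : Type} [AddCommGroup X] [Module (PreprojA3 k) X] [Module k X]
    [IsScalarTower k (PreprojA3 k) X]

/-- the action of a generator as a linear map -/
def lact (a : PreprojGen) : X →ₗ[k] X := Algebra.lsmul k k X (gen k a)

@[simp] lemma lact_apply (a : PreprojGen) (x : X) : lact (k := k) a x = gen k a • x := rfl

lemma cond_of_ext_left (H : ExtS (L := PreprojA3 k) (NN k) X) : Cond k X := by
  refine ⟨fun v h1 h2 => ?_, fun v h1 h2 => ?_, fun v h1 h2 h3 => ?_⟩
  · obtain ⟨s, r, hsr⟩ := R1_NN k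
    obtain ⟨h, -, -, -, -, -, hh, -⟩ := twist
      ((LinearMap.snd k k k ∘ₗ (E1 k).toLinearMap).smulRight (gen k y2 • v)) 0
      ((LinearMap.fst k k k ∘ₗ (E1 k).toLinearMap).smulRight v) 0
      (by simp [gen_smul_k]) (by simp [T1_apply, t1]) (by simp) (by simp)
      (by simp [gen_smul_k, h1]) (by simp [T1_apply, t1]) (by simp) (by simp)
      (by simp [gen_smul_k, h2]) (by simp [T1_apply, t1]) (by simp [T1_apply, t1, gen_smul_k])
      (H.retract_left s r hsr)
    refine ⟨h (z1 k), ?_⟩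
    rw [← hh]
    simp [T1_apply, t1]
  · obtain ⟨s, r, hsr⟩ := R2_NN k
    obtain ⟨h, -, -, -, -, hh, -, -⟩ := twist 0
      ((LinearMap.fst k k k ∘ₗ (E2 k).toLinearMap).smulRight v) 0
      ((LinearMap.snd k k k ∘ₗ (E2 k).toLinearMap).smulRight (gen k x1 • v))
      (by simp) (by simp) (by simp [gen_smul_k, h1]) (by simp [T2_apply, t2]) (by simp) (by simp)
      (by simp [gen_smul_k]) (by simp [T2_apply, t2])
      (by simp [T2_apply, t2]) (by simp [gen_smul_k, h2]) (by simp [T2_apply, t2, gen_smul_k])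
      (H.retract_left s r hsr)
    refine ⟨h (z2 k), ?_⟩
    rw [← hh]
    simp [T2_apply, t2]
  · obtain ⟨s, r, hsr⟩ := R3_NN k
    obtain ⟨h, -, -, -, hx1, hy1, -, -⟩ := twist
      ((LinearMap.fst k k k ∘ₗ LinearMap.snd k k (k × k) ∘ₗ (E3 k).toLinearMap).smulRight v) 0 0
      ((LinearMap.snd k k k ∘ₗ LinearMap.snd k k (k × k) ∘ₗ (E3 k).toLinearMap).smulRight v)
      (by simp [gen_smul_k, h1]) (by simp [T3_apply, t3]) (by simp) (by simp) (by simp) (by simp)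
      (by simp [gen_smul_k, h1]) (by simp [T3_apply, t3])
      (by simp [gen_smul_k, h2]) (by simp [gen_smul_k, h3]) (by simp [T3_apply, t3, gen_smul_k])
      (H.retract_left s r hsr)
    refine ⟨h (z3 k), ?_⟩
    rw [← hy1, LinearMap.zero_apply, add_zero, ← hx1]
    simp [T3_apply, t3]

lemma cond_of_ext_right (H : ExtS (L := PreprojA3 k) X (NN k)) : Cond k X := by
  refine ⟨fun v h1 h2 => ?_, fun v h1 h2 => ?_, fun v h1 h2 h3 => ?_⟩ <;> by_contra hcon
  · obtain ⟨s, r, hsr⟩ := R1_NN k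
    obtain ⟨f, f1, f2⟩ := exists_fun (LinearMap.range (lact (k := k) (X := X) x2)) v
      (by rintro ⟨u, hu⟩; exact hcon ⟨u, hu⟩)
    have f2' : ∀ u, f (gen k x2 • u) = 0 := fun u => f2 _ ⟨u, rfl⟩
    obtain ⟨h, -, -, -, -, hy1, -, hy2⟩ := twist 0 0 0
      ((f ∘ₗ lact e3).smulRight (z1 k))
      (by simp) (by simp) (by simp) (by simp) (by simp) (by simp)
      (by simp [gen_smul_k, T1_apply, t1]) (by simp)
      (by simp) (by simp [gen_smul_k, T1_apply, t1]) (by simp [f2'])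
      (H.retract_right s r hsr)
    have a1 := hy2 v
    have a2 := hy1 (gen k y2 • v)
    obtain ⟨⟨p, q⟩, hp⟩ := (E1 k).symm.surjective (h v)
    rw [← hp] at a1
    have a3 : h (gen k y2 • v) = - z1 k := by
      simpa [h1, f1, T1_apply, t1, ← eq_neg_iff_add_eq_zero] using a1
    rw [h2, a3] at a2
    simp [T1_apply, t1, zero_eq', ← map_neg] at a2
  · obtain ⟨s, r, hsr⟩ := R2_NN k
    obtain ⟨f, f1, f2⟩ := exists_fun (LinearMap.range (lact (k := k) (X := X) y1)) v
      (by rintro ⟨u, hu⟩; exact hcon ⟨u, hu⟩)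
    have f2' : ∀ u, f (gen k y1 • u) = 0 := fun u => f2 _ ⟨u, rfl⟩
    obtain ⟨h, -, -, -, hx1, -, hx2, -⟩ := twist ((f ∘ₗ lact e1).smulRight (z2 k)) 0 0 0
      (by simp [gen_smul_k, T2_apply, t2]) (by simp)
      (by simp) (by simp) (by simp) (by simp) (by simp) (by simp)
      (by simp [gen_smul_k, T2_apply, t2]) (by simp) (by simp [f2'])
      (H.retract_right s r hsr)
    have a1 := hx1 v
    have a2 := hx2 (gen k x1 • v)
    obtain ⟨⟨p, q⟩, hp⟩ := (E2 k).symm.surjective (h v)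
    rw [← hp] at a1
    have a3 : h (gen k x1 • v) = - z2 k := by
      simpa [h1, f1, T2_apply, t2, ← eq_neg_iff_add_eq_zero] using a1
    rw [h2, a3] at a2
    simp [T2_apply, t2, zero_eq', ← map_neg] at a2
  · obtain ⟨s, r, hsr⟩ := R3_NN k
    obtain ⟨f, f1, f2⟩ := exists_fun
      (LinearMap.range (lact (k := k) (X := X) x1 ∘ₗ lact y1)) v
      (by rintro ⟨u, hu⟩; exact hcon ⟨u, hu⟩)
    have f2' : ∀ u, f (gen k x1 • gen k y1 • u) = 0 := fun u => f2 _ ⟨u, rfl⟩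
    obtain ⟨h, -, -, -, -, hy1, hx2, -⟩ := twist
      (-(f ∘ₗ lact x1).smulRight (z3 k)) ((f ∘ₗ lact e2).smulRight (gen k y1 • z3 k)) 0 0
      (by simp [gen_smul_k, T3_apply, t3]) (by simp)
      (by simp [gen_smul_k, T3_apply, t3]) (by simp) (by simp) (by simp) (by simp) (by simp)
      (by simp [gen_smul_k, T3_apply, t3]) (by simp)
      (by simp [gen_smul_k, T3_apply, t3, f2'])
      (H.retract_right s r hsr)
    have a1 := hy1 v
    have a2 := hx2 v
    obtain ⟨⟨p, q, t⟩, hp⟩ := (E3 k).symm.surjective (h v)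
    rw [← hp] at a1 a2
    simp [h1, h2, f1, T3_apply, t3] at a1
    simp [h3, T3_apply, t3, zero_eq', ← a1] at a2

end ExtToCond


section Decompose

variable {k}

/-- `X` has a nonzero direct summand in `add N`. -/
def Splits' (X : Type) [AddCommGroup X] [Module (PreprojA3 k) X] : Prop :=
  ∃ (M : Type) (_ : AddCommGroup M) (_ : Module (PreprojA3 k) M) (φ : M →ₗ[PreprojA3 k] X)
    (ψ : X →ₗ[PreprojA3 k] M), Retr (k := k) M (NN k) ∧ (∀ m, ψ (φ m) = m) ∧ ∃ m : M, m ≠ 0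

variable {X : Type} [AddCommGroup X] [Module (PreprojA3 k) X] [Module k X]
    [IsScalarTower k (PreprojA3 k) X]

lemma split_Q2 (h : ∃ v : X, gen k x1 • gen k y1 • v ≠ 0) : Splits' (k := k) X := by
  obtain ⟨v', hv'⟩ := h
  obtain ⟨v, hv, he⟩ : ∃ v : X, gen k x1 • gen k y1 • v ≠ 0 ∧ gen k e2 • v = v :=
    ⟨gen k e2 • v', by simpa using hv', by simp⟩
  obtain ⟨f, f1, f2⟩ := exists_fun (k := k) (Submodule.span k {v}) (gen k x1 • gen k y1 • v) (by
    intro hm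
    obtain ⟨c, hc⟩ := Submodule.mem_span_singleton.1 hm
    have h2 : gen k x1 • gen k y1 • (c • v) = 0 := by rw [hc]; simp
    simp only [gen_smul_k] at h2
    rcases smul_eq_zero.1 h2 with h3 | h3
    · rw [h3, zero_smul] at hc; exact hv hc.symm
    · exact hv h3)
  have f3 : f v = 0 := f2 _ (Submodule.mem_span_singleton_self v)
  obtain ⟨k1, k2, k3, k4⟩ := kills2 he
  obtain ⟨φ, hφ⟩ := from_Q2 v he
  refine ⟨Q2 k, inferInstance, inferInstance, φ,
    mkLin ((F2 k).symm.toLinearMap ∘ₗ ((f ∘ₗ lact x1 ∘ₗ lact y1).prod ((f ∘ₗ lact x1).prod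
      ((f ∘ₗ lact y2).prod (f ∘ₗ lact e2))))) ?_, (Q2_retr k).trans (A_NN k), ?_,
    (F2 k).symm (1, 0, 0, 0), by simp⟩
  · intro a x
    cases a <;> simp [U2_apply, q2]
  · intro m
    obtain ⟨⟨p, q, r, s⟩, rfl⟩ := (F2 k).symm.surjective m
    rw [hφ]
    simp [smul_add, gen_smul_k, f1, f3, k1, k2, k3, k4, he]

lemma split_Q1 (h : ∃ v : X, gen k x2 • gen k x1 • v ≠ 0) : Splits' (k := k) X := by
  obtain ⟨v', hv'⟩ := h
  obtain ⟨v, hv, he⟩ : ∃ v : X, gen k x2 • gen k x1 • v ≠ 0 ∧ gen k e1 • v = v :=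
    ⟨gen k e1 • v', by simpa using hv', by simp⟩
  obtain ⟨f, f1, -⟩ := exists_fun (k := k) ⊥ (gen k x2 • gen k x1 • v) (by simpa using hv)
  obtain ⟨k1, k2, k3, k4, k5⟩ := kills1 he
  obtain ⟨φ, hφ⟩ := from_Q1 v he
  refine ⟨Q1 k, inferInstance, inferInstance, φ,
    mkLin ((F1 k).symm.toLinearMap ∘ₗ ((f ∘ₗ lact x2 ∘ₗ lact x1).prod ((f ∘ₗ lact x2).prod
      (f ∘ₗ lact e3)))) ?_, (Q1_retr k).trans (A_NN k), ?_,
    (F1 k).symm (1, 0, 0), by simp⟩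
  · intro a x
    cases a <;> simp [U1_apply, q1]
  · intro m
    obtain ⟨⟨p, q, r⟩, rfl⟩ := (F1 k).symm.surjective m
    rw [hφ]
    simp [smul_add, gen_smul_k, f1, k1, k2, k3, k4, k5, he]

lemma split_Q3 (h : ∃ v : X, gen k y1 • gen k y2 • v ≠ 0) : Splits' (k := k) X := by
  obtain ⟨v', hv'⟩ := h
  obtain ⟨v, hv, he⟩ : ∃ v : X, gen k y1 • gen k y2 • v ≠ 0 ∧ gen k e3 • v = v :=
    ⟨gen k e3 • v', by simpa using hv', by simp⟩
  obtain ⟨f, f1, -⟩ := exists_fun (k := k) ⊥ (gen k y1 • gen k y2 • v) (by simpa using hv)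
  obtain ⟨k1, k2, k3, k4, k5⟩ := kills3 he
  obtain ⟨φ, hφ⟩ := from_Q3 v he
  refine ⟨Q3 k, inferInstance, inferInstance, φ,
    mkLin ((F3 k).symm.toLinearMap ∘ₗ ((f ∘ₗ lact y1 ∘ₗ lact y2).prod ((f ∘ₗ lact y1).prod
      (f ∘ₗ lact e1)))) ?_, (Q3_retr k).trans (A_NN k), ?_,
    (F3 k).symm (1, 0, 0), by simp⟩
  · intro a x
    cases a <;> simp [U3_apply, q3]
  · intro m
    obtain ⟨⟨p, q, r⟩, rfl⟩ := (F3 k).symm.surjective m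
    rw [hφ]
    simp [smul_add, gen_smul_k, f1, k1, k2, k3, k4, k5, he]

lemma split_R2 (v : X) (he : gen k e2 • v = v) (hy : gen k y1 • v = 0) (hx : gen k x2 • v ≠ 0)
    (a1 : ∀ x : X, gen k x1 • x = 0) (a2 : ∀ x : X, gen k y2 • x = 0) :
    Splits' (k := k) X := by
  obtain ⟨f, f1, -⟩ := exists_fun (k := k) ⊥ (gen k x2 • v) (by simpa using hx)
  obtain ⟨k1, k2, k3, k4⟩ := kills2 he
  obtain ⟨φ, hφ⟩ := from_R2 v he hy
  refine ⟨R2 k, inferInstance, inferInstance, φ,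
    mkLin ((E2 k).symm.toLinearMap ∘ₗ ((f ∘ₗ lact x2).prod (f ∘ₗ lact e3))) ?_, R2_NN k, ?_,
    (E2 k).symm (1, 0), by simp⟩
  · intro a x
    cases a <;> simp [T2_apply, t2, a1]
  · intro m
    obtain ⟨⟨p, q⟩, rfl⟩ := (E2 k).symm.surjective m
    rw [hφ]
    simp [smul_add, gen_smul_k, f1, k1, k2, k3, k4, he]

lemma split_R1 (v : X) (he : gen k e2 • v = v) (hy : gen k x2 • v = 0) (hx : gen k y1 • v ≠ 0)
    (a1 : ∀ x : X, gen k x1 • x = 0) (a2 : ∀ x : X, gen k y2 • x = 0) :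
    Splits' (k := k) X := by
  obtain ⟨f, f1, -⟩ := exists_fun (k := k) ⊥ (gen k y1 • v) (by simpa using hx)
  obtain ⟨k1, k2, k3, k4⟩ := kills2 he
  obtain ⟨φ, hφ⟩ := from_R1 v he hy
  refine ⟨R1 k, inferInstance, inferInstance, φ,
    mkLin ((E1 k).symm.toLinearMap ∘ₗ ((f ∘ₗ lact y1).prod (f ∘ₗ lact e1))) ?_, R1_NN k, ?_,
    (E1 k).symm (1, 0), by simp⟩
  · intro a x
    cases a <;> simp [T1_apply, t1, a2]
  · intro m
    obtain ⟨⟨p, q⟩, rfl⟩ := (E1 k).symm.surjective m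
    rw [hφ]
    simp [smul_add, gen_smul_k, f1, k1, k2, k3, k4, he]

lemma exists_ext (a : PreprojGen) (ha : ∀ x : X, gen k a • gen k e2 • x = gen k a • x)
    (h : ∀ x : X, gen k e2 • x = x → gen k a • x = 0 → x = 0)
    (f : X →ₗ[k] k) : ∃ f' : X →ₗ[k] k, ∀ x, f' (gen k a • x) = f (gen k e2 • x) := by
  let S := LinearMap.range (lact (k := k) (X := X) e2)
  obtain ⟨g, hg⟩ := LinearMap.exists_leftInverse_of_injective 
    ((lact (k := k) (X := X) a).domRestrict S) (by
    rw [LinearMap.ker_eq_bot']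
    rintro ⟨_, x, rfl⟩ hx
    exact Subtype.ext (h _ (by simp) hx))
  refine ⟨f ∘ₗ S.subtype ∘ₗ g, fun x => ?_⟩
  have := LinearMap.congr_fun hg ⟨gen k e2 • x, x, rfl⟩
  have h2 : g (gen k a • x) = ⟨gen k e2 • x, x, rfl⟩ := by
    rw [← ha]; exact this
  simp [h2]

lemma split_R3 (v : X) (he : gen k e2 • v = v) (hv : v ≠ 0)
    (i1 : ∀ x : X, gen k e2 • x = x → gen k y1 • x = 0 → x = 0)
    (i2 : ∀ x : X, gen k e2 • x = x → gen k x2 • x = 0 → x = 0)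
    (a1 : ∀ x : X, gen k x1 • x = 0) (a2 : ∀ x : X, gen k y2 • x = 0) :
    Splits' (k := k) X := by
  obtain ⟨f, f1, -⟩ := exists_fun (k := k) ⊥ v (by simpa using hv)
  obtain ⟨g1, hg1⟩ := exists_ext y1 (by simp) i1 f
  obtain ⟨g2, hg2⟩ := exists_ext x2 (by simp) i2 f
  obtain ⟨k1, k2, k3, k4⟩ := kills2 he
  obtain ⟨φ, hφ⟩ := from_R3 v he (a1 _)
  refine ⟨R3 k, inferInstance, inferInstance, φ,
    mkLin ((E3 k).symm.toLinearMap ∘ₗ ((f ∘ₗ lact e2).prod ((g1 ∘ₗ lact e1).prod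
      (g2 ∘ₗ lact e3)))) ?_, R3_NN k, ?_,
    (E3 k).symm (1, 0, 0), by simp⟩
  · intro a x
    cases a <;> simp [T3_apply, t3, a1, a2, hg1, hg2]
  · intro m
    obtain ⟨⟨p, q, r⟩, rfl⟩ := (E3 k).symm.surjective m
    rw [hφ]
    simp [smul_add, gen_smul_k, f1, hg1, hg2, k1, k2, k3, k4, he]

lemma cond_splits (hX : Cond k X) (hn : ∃ x : X, x ≠ 0) : Splits' (k := k) X := by
  by_cases c1 : ∃ v : X, gen k x1 • gen k y1 • v ≠ 0
  · exact split_Q2 c1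
  by_cases c2 : ∃ v : X, gen k x2 • gen k x1 • v ≠ 0
  · exact split_Q1 c2
  by_cases c3 : ∃ v : X, gen k y1 • gen k y2 • v ≠ 0
  · exact split_Q3 c3
  push Not at c1 c2 c3
  obtain ⟨ha, hb, hc⟩ := hX
  have a1 : ∀ x : X, gen k x1 • x = 0 := fun x => by
    obtain ⟨u, hu⟩ := hc (gen k x1 • x) (by simp) (by simp) (c2 x)
    rw [← hu, c1]
  have a2 : ∀ x : X, gen k y2 • x = 0 := fun x => by
    obtain ⟨u, hu⟩ := hc (gen k y2 • x) (by simp) (c3 x) (by simp)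
    rw [← hu, c1]
  have hc' : ∀ x : X, gen k e2 • x = x → gen k y1 • x = 0 → gen k x2 • x = 0 → x = 0 :=
    fun x h1 h2 h3 => by
      obtain ⟨u, hu⟩ := hc x h1 h2 h3
      rw [← hu, c1]
  by_cases i1 : ∀ x : X, gen k e2 • x = x → gen k y1 • x = 0 → x = 0
  swap
  · push Not at i1
    obtain ⟨v, h1, h2, h3⟩ := i1
    exact split_R2 v h1 h2 (fun h => h3 (hc' v h1 h2 h)) a1 a2
  by_cases i2 : ∀ x : X, gen k e2 • x = x → gen k x2 • x = 0 → x = 0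
  swap
  · push Not at i2
    obtain ⟨v, h1, h2, h3⟩ := i2
    exact split_R1 v h1 h2 (fun h => h3 (hc' v h1 h h2)) a1 a2
  by_cases hz : ∀ x : X, gen k e2 • x = 0
  · exfalso
    obtain ⟨x, hx⟩ := hn
    apply hx
    obtain ⟨u, hu⟩ := ha (gen k e3 • x) (by simp) (c3 _)
    obtain ⟨u', hu'⟩ := hb (gen k e1 • x) (by simp) (c2 _)
    rw [← act_sum (k := k) x, ← hu, ← hu', hz, ← act_x2e2, hz, ← act_y1e2, hz]
    simp
  · push Not at hz
    obtain ⟨x, hx⟩ := hz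
    exact split_R3 _ (act_e2e2 x) hx i1 i2 a1 a2

lemma inAdd_of_cond_aux (n : ℕ) : ∀ (X : Type) [AddCommGroup X] [Module (PreprojA3 k) X]
    [Module k X] [IsScalarTower k (PreprojA3 k) X] [Module.Finite k X], Cond k X →
    Module.finrank k X = n → InAdd (L := PreprojA3 k) (NN k) X := by
  induction n using Nat.strong_induction_on with
  | _ n ih =>
    intro X _ _ _ _ _ hX hn
    by_cases h0 : ∃ x : X, x ≠ 0
    · obtain ⟨M, _, _, φ, ψ, hM, hφ, m, hm⟩ := cond_splits hX h0
      have hk : ∀ x, x - φ (ψ x) ∈ LinearMap.ker ψ := fun x => by simp [hφ]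
      let s' : X →ₗ[PreprojA3 k] LinearMap.ker ψ :=
        (LinearMap.id - φ.comp ψ).codRestrict _ hk
      have hlt : Module.finrank k ((LinearMap.ker ψ).restrictScalars k) < Module.finrank k X := by
        apply Submodule.finrank_lt
        intro htop
        have : φ m ∈ (LinearMap.ker ψ).restrictScalars k := by rw [htop]; trivial
        have h2 : ψ (φ m) = 0 := this
        rw [hφ] at h2
        exact hm h2
      have hfin : Module.Finite k (LinearMap.ker ψ) :=
        inferInstanceAs (Module.Finite k ((LinearMap.ker ψ).restrictScalars k))
      refine InAdd.of_sum ψ φ s' (LinearMap.ker ψ).subtype (fun x => by simp [s'])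
        (InAdd.of_retr hM) ?_
      refine ih _ (hn ▸ hlt) (LinearMap.ker ψ) ?_ rfl
      refine hX.of_retract (LinearMap.ker ψ).subtype s' fun x => Subtype.ext ?_
      have : ψ x = 0 := x.2
      simp [s', this]
    · push Not at h0
      exact ⟨0, Fin.elim0, Fin.elim0, fun x => by simp [h0 x]⟩

lemma inAdd_of_cond [Module.Finite k X] (hX : Cond k X) : InAdd (L := PreprojA3 k) (NN k) X :=
  inAdd_of_cond_aux _ X hX rfl

end Decompose


section Final

variable {k}

lemma cond_simple {S : Type} [AddCommGroup S] [Module (PreprojA3 k) S]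
    [IsSimpleModule (PreprojA3 k) S] : ¬ Cond k S := by
  intro hS
  letI : Module k S := Module.compHom S (algebraMap k (PreprojA3 k))
  haveI : IsScalarTower k (PreprojA3 k) S := IsScalarTower.of_algebraMap_smul fun _ _ => rfl
  -- elements killed by all the arrows
  let T : Submodule (PreprojA3 k) S :=
    { carrier := {m | gen k x1 • m = 0 ∧ gen k y1 • m = 0 ∧ gen k x2 • m = 0 ∧ gen k y2 • m = 0}
      add_mem' := by
        rintro a b ⟨h1, h2, h3, h4⟩ ⟨h1', h2', h3', h4'⟩
        exact ⟨by rw [smul_add, h1, h1', add_zero], by rw [smul_add, h2, h2', add_zero],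
          by rw [smul_add, h3, h3', add_zero], by rw [smul_add, h4, h4', add_zero]⟩
      zero_mem' := ⟨smul_zero _, smul_zero _, smul_zero _, smul_zero _⟩
      smul_mem' := by
        intro c
        induction c using gen_induction with
        | hc c =>
          rintro m ⟨h1, h2, h3, h4⟩
          simp only [algebraMap_smul, Set.mem_ofPred_eq, gen_smul_k, h1, h2, h3, h4, smul_zero,
            and_self]
        | hg a =>
          rintro m ⟨h1, h2, h3, h4⟩
          cases a <;> simp [h1, h2, h3, h4]
        | hm a b h1 h2 =>
          intro m hm
          rw [mul_smul]
          exact h1 (h2 hm)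
        | ha a b h1 h2 =>
          intro m hm
          obtain ⟨p1, p2, p3, p4⟩ := h1 hm
          obtain ⟨q1, q2, q3, q4⟩ := h2 hm
          rw [add_smul]
          exact ⟨by rw [smul_add, p1, q1, add_zero], by rw [smul_add, p2, q2, add_zero],
            by rw [smul_add, p3, q3, add_zero], by rw [smul_add, p4, q4, add_zero]⟩ }
  have memT : ∀ m : S, gen k x1 • m = 0 → gen k y1 • m = 0 → gen k x2 • m = 0 →
      gen k y2 • m = 0 → m ∈ T := fun m h1 h2 h3 h4 => ⟨h1, h2, h3, h4⟩
  have hT : T = ⊤ := by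
    rcases eq_bot_or_eq_top T with h | h
    · have z : ∀ m : S, gen k x1 • m = 0 → gen k y1 • m = 0 → gen k x2 • m = 0 →
          gen k y2 • m = 0 → m = 0 := fun m h1 h2 h3 h4 => by
        have := memT m h1 h2 h3 h4
        rwa [h, Submodule.mem_bot] at this
      have w1 : ∀ m : S, gen k x1 • gen k y1 • m = 0 := fun m =>
        z _ (by simp) (by simp) (by simp) (by simp)
      have w2 : ∀ m : S, gen k x2 • gen k x1 • m = 0 := fun m =>
        z _ (by simp) (by simp) (by simp) (by simp [w1])
      have w3 : ∀ m : S, gen k y1 • gen k y2 • m = 0 := fun m =>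
        z _ (by simp [w1]) (by simp) (by simp) (by simp)
      rw [eq_top_iff]
      intro m _
      exact memT m (z _ (by simp) (by simp) (w2 m) (by simp))
        (z _ (w1 m) (by simp) (by simp) (by simp))
        (z _ (by simp) (by simp) (by simp) (by simp [w1]))
        (z _ (by simp) (w3 m) (by simp) (by simp))
    · exact h
  have hz : ∀ m : S, gen k x1 • m = 0 ∧ gen k y1 • m = 0 ∧ gen k x2 • m = 0 ∧ gen k y2 • m = 0 :=
    fun m => by
      have : m ∈ T := by rw [hT]; trivial
      exact this
  obtain ⟨ha, hb, hc⟩ := hS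
  have h0 : ∀ m : S, m = 0 := fun m => by
    obtain ⟨u, hu⟩ := ha (gen k e3 • m) (by simp) (hz _).2.1
    obtain ⟨u', hu'⟩ := hb (gen k e1 • m) (by simp) (hz _).2.2.1
    obtain ⟨u'', hu''⟩ := hc (gen k e2 • m) (by simp) (hz _).2.1 (hz _).2.2.1
    rw [← act_sum (k := k) m, ← hu, ← hu', ← hu'', (hz _).2.1, (hz _).1, (hz _).2.2.1]
    simp
  haveI := IsSimpleModule.nontrivial (PreprojA3 k) S
  obtain ⟨x, hx⟩ := exists_ne (0 : S)
  exact hx (h0 x)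

variable (k)

lemma NN_ct : IsClusterTilting 2 (NN k) := by
  have hi : ∀ P : ℕ → Prop, (∀ i, 1 ≤ i → i ≤ 2 - 1 → P i) ↔ P 1 := fun P =>
    ⟨fun h => h 1 le_rfl le_rfl, fun h i h1 h2 => by
      have : i = 1 := by omega
      rwa [this]⟩
  have hNN : ExtS (L := PreprojA3 k) (NN k) (NN k) := extS_N (cond_NN k)
  refine ⟨finNN k, fun X hX => ?_, fun X hX => ?_⟩
  all_goals
    rw [hi, extVanish_iff, memAdd_iff]
    letI : Module k X := Module.compHom X (algebraMap k (PreprojA3 k))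
    haveI : IsScalarTower k (PreprojA3 k) X := IsScalarTower.of_algebraMap_smul fun _ _ => rfl
    haveI : Module.Finite k X := Module.Finite.trans (PreprojA3 k) X
  · refine ⟨?_, fun H => inAdd_of_cond (cond_of_ext_right H)⟩
    rintro ⟨n, s, r, h⟩
    exact hNN.sum_left n s r h
  · refine ⟨?_, fun H => inAdd_of_cond (cond_of_ext_left H)⟩
    rintro ⟨n, s, r, h⟩
    exact hNN.sum_right n s r h

lemma NN_simple (S : ModuleCat (PreprojA3 k)) (hS : Simple S) : ¬ IsSummand S (NN k) := by
  rintro ⟨s, r, h⟩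
  haveI : IsSimpleModule (PreprojA3 k) S := (simple_iff_isSimpleModule' S).1 hS
  refine cond_simple (k := k) (S := S) ((cond_NN k).of_retract s.hom r.hom fun x => ?_)
  exact LinearMap.congr_fun (congrArg ModuleCat.Hom.hom h) x

end Final


/-- `N = A ⊕ [2;1] ⊕ [2;3] ⊕ [2;13]` is a `2`-cluster-tilting module over the preprojective
algebra of type `𝔸₃`; it has no simple direct summands, and consequently `Ext²(S, S') ≠ 0`
holds for no pair of simple direct summands of `N` (the `Ext²`-quiver of `add N` is
empty). -/
theorem preproj_N_two_cluster_tilting_no_simple_summands :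
    IsClusterTilting 2 (NN k) ∧
    (∀ S : ModuleCat (PreprojA3 k), Simple S → ¬ IsSummand S (NN k)) ∧
    (∀ S S' : ModuleCat (PreprojA3 k), Simple S → Simple S' →
      IsSummand S (NN k) → IsSummand S' (NN k) → ExtVanish 2 S S') := by
  exact ⟨NN_ct k, NN_simple k, fun S _ hS _ h _ => absurd h (NN_simple k S hS)⟩

end
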